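/- arXiv:2110.04688 — 2 statements merged into one kernel-verified Lean document; each statement's English description precedes it below -/
import Mathlib

section
/- Suppose (A1)–(A3) hold, and let (σ, R) be any solution of the evolutionary tumor problem on [0,∞) with R(0) = R₀ > 0. If S̄ ≤ 0, then lim_{t→+∞} R(t) = 0. -/
open MeasureTheory Set Filter Topology

/-- Heaviside function: `H s = 1` for `s > 0`, `H s = 0` for `s ≤ 0`. -/
noncomputable def Hside (s : ℝ) : ℝ := if 0 < s then 1 else 0

/-- Assumption (A1)/(A2): `f ∈ C¹[0,∞)` is strictly increasing. -/
def C1StrictInc (f : ℝ → ℝ) : Prop :=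
  ContDiffOn ℝ 1 f (Ici 0) ∧ StrictMonoOn f (Ici 0)

/-- Proliferation rate `S`: `S s = g s` if `s > σD`, `S s = -ν` otherwise. -/
noncomputable def Sfun (g : ℝ → ℝ) (σD ν s : ℝ) : ℝ := if σD < s then g s else -ν

/-- A solution of the stationary radial nutrient problem with boundary parameter
`σbar` and radius `R`: `σ` is continuous on `[0,R]`, differentiable on `(0,R]`
with derivative `σ'` there, satisfies
`r² σ'(r) = ∫₀^r l² f(σ l) H(σ l − σD) dl` on `(0,R]` (encoding the ODE together
with `σ'(0) = 0`), and the Robin condition `σ'(R) + β (σ(R) − σbar) = 0`. -/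
structure IsStationarySol (f : ℝ → ℝ) (β σD σbar R : ℝ) (σ σ' : ℝ → ℝ) : Prop where
  cont : ContinuousOn σ (Icc 0 R)
  deriv : ∀ r ∈ Ioc (0:ℝ) R, HasDerivWithinAt σ (σ' r) (Icc 0 R) r
  ode : ∀ r ∈ Ioc (0:ℝ) R,
    r ^ 2 * σ' r = ∫ l in (0:ℝ)..r, l ^ 2 * f (σ l) * Hside (σ l - σD)
  robin : σ' R + β * (σ R - σbar) = 0

/-- A solution of the evolutionary tumor problem on `[0,∞)`: `R` is positive and
differentiable on `[0,∞)` with derivative `R'`, for each `t ≥ 0` the radial profile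
`σ(·,t)` solves the stationary problem with parameters `φ t` and `R t`, and
`R(t)² R'(t) = ∫₀^{R(t)} S(σ(r,t)) r² dr` for `t > 0`. -/
structure IsEvolutionSol (f g : ℝ → ℝ) (β σD ν : ℝ) (φ : ℝ → ℝ)
    (σ : ℝ → ℝ → ℝ) (R R' : ℝ → ℝ) : Prop where
  pos : ∀ t ≥ (0:ℝ), 0 < R t
  stat : ∀ t ≥ (0:ℝ), ∃ σ', IsStationarySol f β σD (φ t) (R t) (fun r => σ r t) σ'
  deriv : ∀ t ≥ (0:ℝ), HasDerivWithinAt R (R' t) (Ici 0) t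
  ode : ∀ t > (0:ℝ), (R t) ^ 2 * R' t = ∫ r in (0:ℝ)..(R t), Sfun g σD ν (σ r t) * r ^ 2

theorem Sfun_mono {g : ℝ → ℝ} {σD ν : ℝ} (hσD : 0 < σD) (hg : C1StrictInc g)
    (hgν : 0 ≤ g σD + ν) : Monotone (Sfun g σD ν) := by
  intro x y hxy
  unfold Sfun
  split_ifs with h1 h2 h2
  · exact hg.2.monotoneOn (mem_Ici.2 (by linarith)) (mem_Ici.2 (by linarith)) hxy
  · exact absurd (lt_of_lt_of_le h1 hxy) h2
  · have := hg.2 (mem_Ici.2 hσD.le) (mem_Ici.2 (by linarith)) h2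
    linarith
  · exact le_rfl

theorem f_pos {f : ℝ → ℝ} (hf : C1StrictInc f) (hf0 : f 0 = 0) {x : ℝ} (hx : 0 < x) :
    0 < f x := by
  have := hf.2 (mem_Ici.2 le_rfl) (mem_Ici.2 hx.le) hx
  linarith

theorem fH_mono {f : ℝ → ℝ} {σD : ℝ} (hσD : 0 < σD) (hf : C1StrictInc f) (hf0 : f 0 = 0) :
    Monotone (fun s => f s * Hside (s - σD)) := by
  intro x y hxy
  simp only [Hside, sub_pos]
  split_ifs with h1 h2 h2
  · have := hf.2.monotoneOn (mem_Ici.2 (by linarith)) (mem_Ici.2 (by linarith)) hxy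
    linarith
  · exact absurd (lt_of_lt_of_le h1 hxy) h2
  · have := f_pos hf hf0 (hσD.trans h2)
    linarith
  · simp

theorem fH_nonneg {f : ℝ → ℝ} {σD : ℝ} (hσD : 0 < σD) (hf : C1StrictInc f) (hf0 : f 0 = 0)
    (s : ℝ) : 0 ≤ f s * Hside (s - σD) := by
  simp only [Hside, sub_pos]
  split_ifs with h1
  · have := f_pos hf hf0 (hσD.trans h1)
    linarith
  · simp

theorem stat_deriv_nonneg {f : ℝ → ℝ} {β σD sb R : ℝ} {σ σ' : ℝ → ℝ} (hσD : 0 < σD)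
    (hf : C1StrictInc f) (hf0 : f 0 = 0) (h : IsStationarySol f β σD sb R σ σ')
    {r : ℝ} (hr : r ∈ Ioc (0:ℝ) R) : 0 ≤ σ' r := by
  have h1 := h.ode r hr
  have h2 : 0 ≤ ∫ l in (0:ℝ)..r, l ^ 2 * f (σ l) * Hside (σ l - σD) := by
    apply intervalIntegral.integral_nonneg hr.1.le
    intro u _
    rw [mul_assoc]
    exact mul_nonneg (sq_nonneg _) (fH_nonneg hσD hf hf0 _)
  have h3 : 0 < r ^ 2 := pow_pos hr.1 2
  rw [← h1] at h2
  exact nonneg_of_mul_nonneg_right h2 h3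

theorem stat_hasDerivAt {f : ℝ → ℝ} {β σD sb R : ℝ} {σ σ' : ℝ → ℝ}
    (h : IsStationarySol f β σD sb R σ σ') {r : ℝ} (hr : r ∈ Ioo (0:ℝ) R) :
    HasDerivAt σ (σ' r) r :=
  (h.deriv r ⟨hr.1, hr.2.le⟩).hasDerivAt (Icc_mem_nhds hr.1 hr.2)

theorem stat_mono {f : ℝ → ℝ} {β σD sb R : ℝ} {σ σ' : ℝ → ℝ} (hσD : 0 < σD)
    (hf : C1StrictInc f) (hf0 : f 0 = 0) (h : IsStationarySol f β σD sb R σ σ') :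
    MonotoneOn σ (Icc 0 R) := by
  apply monotoneOn_of_deriv_nonneg (convex_Icc 0 R) h.cont
  · intro r hr
    rw [interior_Icc] at hr
    exact (stat_hasDerivAt h hr).differentiableAt.differentiableWithinAt
  · intro r hr
    rw [interior_Icc] at hr
    rw [(stat_hasDerivAt h hr).deriv]
    exact stat_deriv_nonneg hσD hf hf0 h ⟨hr.1, hr.2.le⟩

theorem stat_le {f : ℝ → ℝ} {β σD sb R : ℝ} {σ σ' : ℝ → ℝ} (hβ : 0 < β) (hσD : 0 < σD)
    (hR : 0 < R)
    (hf : C1StrictInc f) (hf0 : f 0 = 0) (h : IsStationarySol f β σD sb R σ σ') :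
    σ R ≤ sb := by
  have h1 := stat_deriv_nonneg hσD hf hf0 h (right_mem_Ioc.2 hR)
  have h2 := h.robin
  by_contra hc
  push Not at hc
  have : 0 < β * (σ R - sb) := mul_pos hβ (by linarith)
  linarith

theorem int_bound {f g : ℝ → ℝ} {β σD ν sb R m : ℝ} {σ σ' : ℝ → ℝ} (hσD : 0 < σD)
    (hR : 0 < R)
    (hf : C1StrictInc f) (hf0 : f 0 = 0) (hg : C1StrictInc g) (hgν : 0 ≤ g σD + ν)
    (h : IsStationarySol f β σD sb R σ σ') (hm : Sfun g σD ν (σ R) ≤ m) :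
    ∫ r in (0:ℝ)..R, Sfun g σD ν (σ r) * r ^ 2 ≤ m * (R ^ 3 / 3) := by
  have hS := Sfun_mono hσD hg hgν
  have hmo := stat_mono hσD hf hf0 h
  have h1 : ∫ r in (0:ℝ)..R, m * r ^ 2 = m * (R ^ 3 / 3) := by
    rw [intervalIntegral.integral_const_mul, integral_pow]
    norm_num
  rw [← h1]
  apply intervalIntegral.integral_mono_on hR.le
  · apply IntervalIntegrable.mul_continuousOn
    · apply MonotoneOn.intervalIntegrable
      rw [uIcc_of_le hR.le]
      exact fun x hx y hy hxy => hS (hmo hx hy hxy)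
    · fun_prop
  · exact Continuous.intervalIntegrable (by fun_prop) _ _
  · intro r hr
    have : Sfun g σD ν (σ r) ≤ m := (hS (hmo hr (right_mem_Icc.2 hR.le) hr.2)).trans hm
    exact mul_le_mul_of_nonneg_right this (sq_nonneg _)

theorem fHint {f : ℝ → ℝ} {β σD sb R : ℝ} {σ σ' : ℝ → ℝ} (hσD : 0 < σD)
    (hf : C1StrictInc f) (hf0 : f 0 = 0) (h : IsStationarySol f β σD sb R σ σ')
    {r s : ℝ} (hr : 0 ≤ r) (hs : r ≤ s) (hR : s ≤ R) :
    IntervalIntegrable (fun l => l ^ 2 * f (σ l) * Hside (σ l - σD)) volume r s := by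
  have hmo := stat_mono hσD hf hf0 h
  have : IntervalIntegrable (fun l => (f (σ l) * Hside (σ l - σD))) volume r s := by
    apply MonotoneOn.intervalIntegrable
    rw [uIcc_of_le hs]
    exact fun x hx y hy hxy => fH_mono hσD hf hf0
      (hmo ⟨hr.trans hx.1, hx.2.trans hR⟩ ⟨hr.trans hy.1, hy.2.trans hR⟩ hxy)
  have h2 := this.continuousOn_mul (show ContinuousOn (fun l : ℝ => l ^ 2) (uIcc r s) by fun_prop)
  simpa only [mul_assoc] using h2

theorem stat_deriv_le {f : ℝ → ℝ} {β σD sb R M : ℝ} {σ σ' : ℝ → ℝ} (hβ : 0 < β) (hσD : 0 < σD)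
    (hf : C1StrictInc f) (hf0 : f 0 = 0) (h : IsStationarySol f β σD sb R σ σ')
    (hM : sb ≤ M) (hDM : 0 ≤ M)
    {r : ℝ} (hr : r ∈ Ioc (0:ℝ) R) : σ' r ≤ f M * R := by
  have hR : 0 < R := hr.1.trans_le hr.2
  have hmo := stat_mono hσD hf hf0 h
  have hle := stat_le hβ hσD hR hf hf0 h
  have hfM : 0 ≤ f M := by
    have := hf.2.monotoneOn (mem_Ici.2 le_rfl) (mem_Ici.2 hDM) hDM
    linarith
  have h1 := h.ode r hr
  have h2 : ∫ l in (0:ℝ)..r, l ^ 2 * f (σ l) * Hside (σ l - σD) ≤ ∫ l in (0:ℝ)..r, r ^ 2 * f M := by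
    apply intervalIntegral.integral_mono_on hr.1.le
      (fHint hσD hf hf0 h le_rfl hr.1.le hr.2) (by simp)
    intro l hl
    rw [mul_assoc]
    have hl2 : l ^ 2 ≤ r ^ 2 := pow_le_pow_left₀ hl.1 hl.2 2
    have : f (σ l) * Hside (σ l - σD) ≤ f M := by
      have hσl : σ l ≤ M :=
        ((hmo ⟨hl.1, hl.2.trans hr.2⟩ (right_mem_Icc.2 hR.le) (hl.2.trans hr.2)).trans hle).trans hM
      simp only [Hside, sub_pos]
      split_ifs with h3
      · rw [mul_one]
        exact hf.2.monotoneOn (mem_Ici.2 (by linarith)) (mem_Ici.2 hDM) hσl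
      · simpa using hfM
    exact mul_le_mul hl2 this (fH_nonneg hσD hf hf0 _) (sq_nonneg _)
  rw [intervalIntegral.integral_const, smul_eq_mul, sub_zero, ← h1] at h2
  have h3 : 0 < r ^ 2 := pow_pos hr.1 2
  have h4 : σ' r ≤ f M * r := by
    apply le_of_mul_le_mul_left _ h3
    linarith
  exact h4.trans (mul_le_mul_of_nonneg_left hr.2 hfM)

theorem stat_gap {f : ℝ → ℝ} {β σD a b δ M : ℝ} (hβ : 0 < β) (hσD : 0 < σD)
    (hf : C1StrictInc f) (hf0 : f 0 = 0) (ha : 0 < a) (hδ : 0 < δ) (hM : 0 < M) (hb : 0 < b) :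
    ∃ c, 0 < c ∧ c ≤ δ / 2 ∧ ∀ (sb R : ℝ) (σ σ' : ℝ → ℝ), IsStationarySol f β σD sb R σ σ' →
      a ≤ R → R ≤ b → σD + δ ≤ sb → sb ≤ M → σ R ≤ sb - c := by
  have hfM : 0 < f M := f_pos hf hf0 hM
  have hfD : 0 < f σD := f_pos hf hf0 hσD
  obtain ⟨K, hK⟩ : ∃ K, K = f M * b := ⟨_, rfl⟩
  have hKpos : 0 < K := hK ▸ mul_pos hfM hb
  obtain ⟨η, hη⟩ : ∃ η, η = min (a / 2) (δ / (4 * K)) := ⟨_, rfl⟩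
  have hηpos : 0 < η := by rw [hη]; positivity
  have hηa : η ≤ a / 2 := hη ▸ min_le_left _ _
  have hηK : K * η ≤ δ / 4 := by
    have : η ≤ δ / (4 * K) := hη ▸ min_le_right _ _
    rw [le_div_iff₀ (by positivity)] at this
    linarith
  refine ⟨min (δ / 2) (f σD * η / (4 * β)), by positivity, min_le_left _ _, ?_⟩
  intro sb R σ σ' h haR hRb hsb hsM
  have hR : 0 < R := ha.trans_le haR
  by_contra hc
  push Not at hc
  have hc1 : sb - σ R < δ / 2 := by
    have := min_le_left (δ / 2) (f σD * η / (4 * β)); linarith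
  have hc2 : sb - σ R < f σD * η / (4 * β) := by
    have := min_le_right (δ / 2) (f σD * η / (4 * β)); linarith
  have hmo := stat_mono hσD hf hf0 h
  have hd : σ R - σ (R - η) ≤ K * (R - (R - η)) := by
    apply Convex.image_sub_le_mul_sub_of_deriv_le (convex_Icc 0 R) h.cont
    · intro r hr
      rw [interior_Icc] at hr
      exact (stat_hasDerivAt h hr).differentiableAt.differentiableWithinAt
    · intro r hr
      rw [interior_Icc] at hr
      rw [(stat_hasDerivAt h hr).deriv, hK]
      exact (stat_deriv_le hβ hσD hf hf0 h hsM hM.le ⟨hr.1, hr.2.le⟩).trans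
        (mul_le_mul_of_nonneg_left hRb hfM.le)
    · exact ⟨by linarith, by linarith⟩
    · exact right_mem_Icc.2 hR.le
    · linarith
  have hlow : ∀ l ∈ Icc (R - η) R, (R / 2) ^ 2 * f σD ≤ l ^ 2 * f (σ l) * Hside (σ l - σD) := by
    intro l hl
    have h1 : σ (R - η) ≤ σ l :=
      hmo ⟨by linarith, by linarith⟩ ⟨by linarith [hl.1], hl.2⟩ hl.1
    have h2 : σD < σ l := by
      have : R - (R - η) = η := by ring
      rw [this] at hd
      linarith
    simp only [Hside, sub_pos, if_pos h2, mul_one]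
    have h3 : f σD ≤ f (σ l) :=
      (hf.2 (mem_Ici.2 hσD.le) (mem_Ici.2 (by linarith)) h2).le
    have h4 : (R / 2) ^ 2 ≤ l ^ 2 := pow_le_pow_left₀ (by linarith) (by linarith [hl.1]) 2
    exact mul_le_mul h4 h3 hfD.le (sq_nonneg _)
  have hi1 : (R / 2) ^ 2 * f σD * η ≤ ∫ l in (R - η)..R, l ^ 2 * f (σ l) * Hside (σ l - σD) := by
    have : ∫ l in (R - η)..R, (R / 2) ^ 2 * f σD = (R / 2) ^ 2 * f σD * η := by
      rw [intervalIntegral.integral_const, smul_eq_mul]; ring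
    rw [← this]
    exact intervalIntegral.integral_mono_on (by linarith) (by simp)
      (fHint hσD hf hf0 h (by linarith) (by linarith) le_rfl) hlow
  have hi0 : 0 ≤ ∫ l in (0:ℝ)..(R - η), l ^ 2 * f (σ l) * Hside (σ l - σD) := by
    apply intervalIntegral.integral_nonneg (by linarith)
    intro u _
    rw [mul_assoc]
    exact mul_nonneg (sq_nonneg _) (fH_nonneg hσD hf hf0 _)
  have hadd := intervalIntegral.integral_add_adjacent_intervals
    (fHint hσD hf hf0 h (r := 0) (s := R - η) le_rfl (by linarith) (by linarith))
    (fHint hσD hf hf0 h (r := R - η) (s := R) (by linarith) (by linarith) le_rfl)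
  have hode := h.ode R (right_mem_Ioc.2 hR)
  rw [← hadd] at hode
  have hR2 : 0 < R ^ 2 := pow_pos hR 2
  have hfin : f σD * η / 4 ≤ σ' R := by
    apply le_of_mul_le_mul_left _ hR2
    nlinarith
  have hrob := h.robin
  rw [lt_div_iff₀ (by positivity)] at hc2
  nlinarith

theorem g_gap {g : ℝ → ℝ} {σD c M δ : ℝ} (hσD : 0 < σD) (hg : C1StrictInc g) (hc : 0 < c)
    (hcδ : c ≤ δ / 2) :
    ∃ d, 0 < d ∧ ∀ s ∈ Icc (σD + δ) M, g (s - c) ≤ g s - d := by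
  rcases (Icc (σD + δ) M).eq_empty_or_nonempty with he | hne
  · exact ⟨1, one_pos, by simp [he]⟩
  have hgc : ContinuousOn g (Ici 0) := hg.1.continuousOn
  have hcont : ContinuousOn (fun s => g s - g (s - c)) (Icc (σD + δ) M) := by
    apply ContinuousOn.sub
    · exact hgc.mono fun x hx => mem_Ici.2 (by linarith [hx.1])
    · apply hgc.comp (by fun_prop)
      intro x hx
      exact mem_Ici.2 (by linarith [hx.1])
  obtain ⟨x, hx, hmin⟩ := isCompact_Icc.exists_isMinOn hne hcont
  refine ⟨g x - g (x - c), ?_, ?_⟩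
  · have h0 : x - c < x := by linarith
    have := hg.2 (mem_Ici.2 (by linarith [hx.1]))
      (mem_Ici.2 (by linarith [hx.1])) h0
    linarith
  · intro s hs
    have := hmin hs
    have h2 : g x - g (x - c) ≤ g s - g (s - c) := this
    linarith

/-- differential inequality for `log R` -/
theorem log_ineq {R R' ψ : ℝ → ℝ} (hpos : ∀ t ≥ (0:ℝ), 0 < R t)
    (hder : ∀ t ≥ (0:ℝ), HasDerivWithinAt R (R' t) (Ici 0) t)
    (hψ : ∀ a b, IntervalIntegrable ψ volume a b)
    (hle : ∀ t > 0, R' t ≤ ψ t * R t) {s t : ℝ} (hs : 0 ≤ s) (hst : s ≤ t) :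
    Real.log (R t) - Real.log (R s) ≤ ∫ u in s..t, ψ u := by
  apply intervalIntegral.sub_le_integral_of_hasDeriv_right_of_le
    (g := fun t => Real.log (R t)) (g' := fun t => R' t / R t) hst
  · intro x hx
    have h0 : 0 ≤ x := hs.trans hx.1
    apply ContinuousWithinAt.log _ (hpos x h0).ne'
    exact (hder x h0).continuousWithinAt.mono fun y hy => mem_Ici.2 (hs.trans hy.1)
  · intro x hx
    have h0 : 0 ≤ x := hs.trans hx.1.le
    apply HasDerivWithinAt.log _ (hpos x h0).ne'
    exact (hder x h0).mono fun y hy => mem_Ici.2 (h0.trans (le_of_lt hy))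
  · exact (intervalIntegrable_iff_integrableOn_Icc_of_le hst).1 (hψ s t)
  · intro x hx
    have h0 : 0 < x := lt_of_le_of_lt hs hx.1
    rw [div_le_iff₀ (hpos x h0.le)]
    exact hle x h0

theorem per_bound {ψ : ℝ → ℝ} {ω M : ℝ} (hω : 0 < ω) (hper : Function.Periodic ψ ω)
    (hψ : ∀ a b, IntervalIntegrable ψ volume a b) (hM : ∀ t, ψ t ≤ M) (hM0 : 0 ≤ M)
    (hint : ∫ t in (0:ℝ)..ω, ψ t ≤ 0) {s t : ℝ} (hst : s ≤ t) :
    ∫ u in s..t, ψ u ≤ M * ω := by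
  obtain ⟨n, hn1, hn2⟩ : ∃ n : ℕ, s + n * ω ≤ t ∧ t < s + n * ω + ω := by
    refine ⟨⌊(t - s) / ω⌋₊, ?_, ?_⟩
    · have := Nat.floor_le (div_nonneg (sub_nonneg.2 hst) hω.le)
      rw [le_div_iff₀ hω] at this
      linarith
    · have := Nat.lt_floor_add_one ((t - s) / ω)
      rw [div_lt_iff₀ hω] at this
      linarith
  have h1 : ∀ k : ℕ, ∫ u in s..(s + k * ω), ψ u ≤ 0 := by
    intro k
    induction k with
    | zero => simp
    | succ k ih =>
      have h2 := intervalIntegral.integral_add_adjacent_intervals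
        (hψ s (s + k * ω)) (hψ (s + k * ω) (s + k * ω + ω))
      have h3 := hper.intervalIntegral_add_eq (s + k * ω) 0
      rw [zero_add] at h3
      have h4 : s + ((k + 1 : ℕ) : ℝ) * ω = s + k * ω + ω := by push_cast; ring
      rw [h4, ← h2, h3]
      linarith
  have h2 := intervalIntegral.integral_add_adjacent_intervals
        (hψ s (s + n * ω)) (hψ (s + n * ω) t)
  have h3 : ∫ u in (s + n * ω)..t, ψ u ≤ ∫ u in (s + n * ω)..t, M :=
    intervalIntegral.integral_mono_on hn1 (hψ _ _) (by simp) (fun x _ => hM x)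
  rw [intervalIntegral.integral_const, smul_eq_mul] at h3
  have h4 : (t - (s + n * ω)) * M ≤ ω * M := mul_le_mul_of_nonneg_right (by linarith) hM0
  linarith [h1 n]

/-- If (A1)–(A3) hold and $\bar S ≤ 0$, then every solution of the evolutionary
tumor problem with $R(0) = R_0 > 0$ satisfies $\lim_{t→∞} R(t) = 0$. -/
theorem stmt_0 (β σD ν ω : ℝ) (hβ : 0 < β) (hσD : 0 < σD) (hν : 0 < ν) (hω : 0 < ω)
    (f g : ℝ → ℝ) (hf : C1StrictInc f) (hf0 : f 0 = 0)
    (hg : C1StrictInc g) (hgz : ∃ σt > σD, g σt = 0) (hgν : 0 ≤ g σD + ν)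
    (φ : ℝ → ℝ) (hφc : Continuous φ) (hφpos : ∀ t, 0 < φ t)
    (hφper : Function.Periodic φ ω)
    (σ : ℝ → ℝ → ℝ) (R R' : ℝ → ℝ) (R₀ : ℝ) (hR₀ : 0 < R₀) (hinit : R 0 = R₀)
    (hsol : IsEvolutionSol f g β σD ν φ σ R R')
    (hSbar : (1 / ω) * ∫ t in (0:ℝ)..ω, Sfun g σD ν (φ t) ≤ 0) :
    Tendsto R atTop (nhds 0) := by
  obtain ⟨hpos, hstat, hder, hode⟩ := hsol
  have hSmono := Sfun_mono hσD hg hgν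
  -- bound on φ
  obtain ⟨M, hM⟩ : ∃ M, ∀ t, φ t ≤ M := by
    obtain ⟨M, hM⟩ := (isCompact_Icc (a := (0:ℝ)) (b := ω)).bddAbove_image hφc.continuousOn
    refine ⟨M, fun t => ?_⟩
    obtain ⟨y, hy, hty⟩ := hφper.exists_mem_Ico₀ hω t
    rw [hty]
    exact hM ⟨y, ⟨hy.1, hy.2.le⟩, rfl⟩
  have hM0 : 0 < M := (hφpos 0).trans_le (hM 0)
  -- S ∘ φ
  have hSper : Function.Periodic (fun t => Sfun g σD ν (φ t)) ω := fun t => by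
    simp only [hφper t]
  have hSint : ∀ a b, IntervalIntegrable (fun t => Sfun g σD ν (φ t)) volume a b := by
    intro a b
    have hmeas : Measurable (fun t => Sfun g σD ν (φ t)) :=
      hSmono.measurable.comp hφc.measurable
    have hbd : ∀ t, ‖Sfun g σD ν (φ t)‖ ≤ max |Sfun g σD ν 0| |Sfun g σD ν M| := fun t => by
      rw [Real.norm_eq_abs]
      exact abs_le_max_abs_abs (hSmono (hφpos t).le) (hSmono (hM t))
    exact (intervalIntegrable_const (c := max |Sfun g σD ν 0| |Sfun g σD ν M|)).mono_fun
      hmeas.aestronglyMeasurable (Eventually.of_forall fun t => by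
        refine (hbd t).trans (le_abs_self _))
  have hSbar' : ∫ t in (0:ℝ)..ω, Sfun g σD ν (φ t) ≤ 0 := by
    by_contra hc
    push Not at hc
    have : 0 < (1 / ω) * ∫ t in (0:ℝ)..ω, Sfun g σD ν (φ t) := mul_pos (by positivity) hc
    linarith
  -- pointwise rate bound
  have hrate : ∀ t > 0, ∀ m, Sfun g σD ν (σ (R t) t) ≤ m → R' t ≤ m / 3 * R t := by
    intro t ht m hm
    obtain ⟨σ', hs⟩ := hstat t ht.le
    have hRt := hpos t ht.le
    have h1 := int_bound hσD hRt hf hf0 hg hgν hs hm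
    have h2 := hode t ht
    rw [← h2] at h1
    have h3 : 0 < R t ^ 2 := pow_pos hRt 2
    apply le_of_mul_le_mul_left _ h3
    linarith
  have hσφ : ∀ t ≥ 0, σ (R t) t ≤ φ t := by
    intro t ht
    obtain ⟨σ', hs⟩ := hstat t ht
    have h1 := stat_le hβ hσD (hpos t ht) hf hf0 hs
    exact h1
  -- quasi-monotonicity
  obtain ⟨C, hC⟩ : ∃ C, ∀ s t, 0 ≤ s → s ≤ t → Real.log (R t) - Real.log (R s) ≤ C := by
    refine ⟨|Sfun g σD ν M| * ω, fun s t hs hst => ?_⟩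
    have hint : ∀ a b, IntervalIntegrable (fun t => Sfun g σD ν (φ t) / 3) volume a b :=
      fun a b => (hSint a b).div_const 3
    refine (log_ineq hpos hder hint ?_ hs hst).trans (per_bound hω ?_ hint ?_ (abs_nonneg _) ?_ hst)
    · exact fun u hu => hrate u hu _ (hSmono (hσφ u hu.le))
    · exact fun t => by simp only [hφper t]
    · intro u
      have h1 := hSmono (hM u)
      have h2 := le_abs_self (Sfun g σD ν M)
      have h3 := abs_nonneg (Sfun g σD ν M)
      linarith
    · rw [intervalIntegral.integral_div]
      linarith
  by_contra hnot
  -- lower bound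
  obtain ⟨a, ha, haR⟩ : ∃ a, 0 < a ∧ ∀ t ≥ 0, a ≤ R t := by
    have : ∃ ε > 0, ∀ T : ℝ, ∃ t ≥ T, ε ≤ R t := by
      by_contra hc
      push Not at hc
      apply hnot
      rw [Metric.tendsto_atTop]
      intro ε hε
      obtain ⟨T, hT⟩ := hc ε hε
      refine ⟨max T 0, fun t ht => ?_⟩
      rw [Real.dist_eq, sub_zero, abs_of_pos (hpos t (le_of_max_le_right ht))]
      exact hT t (le_of_max_le_left ht)
    obtain ⟨ε, hε, hT⟩ := this
    refine ⟨Real.exp (Real.log ε - C), Real.exp_pos _, fun t ht => ?_⟩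
    obtain ⟨u, hu, hεu⟩ := hT t
    rw [← Real.le_log_iff_exp_le (hpos t ht)]
    have h1 := hC t u ht hu
    have h2 := Real.log_le_log hε hεu
    linarith
  obtain ⟨b, hb, hbR⟩ : ∃ b, 0 < b ∧ ∀ t ≥ 0, R t ≤ b := by
    refine ⟨Real.exp (Real.log (R 0) + C), Real.exp_pos _, fun t ht => ?_⟩
    rw [← Real.log_le_iff_le_exp (hpos t ht)]
    linarith [hC 0 t le_rfl ht]
  -- the improved rate
  obtain ⟨ψ, hψper, hψint, hψneg, hψle⟩ : ∃ ψ : ℝ → ℝ, Function.Periodic ψ ω ∧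
      (∀ a b, IntervalIntegrable ψ volume a b) ∧ (∫ t in (0:ℝ)..ω, ψ t < 0) ∧
      ∀ t > 0, R' t ≤ ψ t * R t := by
    by_cases hex : ∃ t, σD < φ t
    · obtain ⟨t₀, ht₀⟩ := hex
      obtain ⟨y, hy, hty⟩ := hφper.exists_mem_Ico₀ hω t₀
      rw [hty] at ht₀
      obtain ⟨δ, hδ, hδy⟩ : ∃ δ > 0, σD + δ < φ y :=
        ⟨(φ y - σD) / 2, by linarith, by linarith⟩
      obtain ⟨c, hc, hcδ, hgap⟩ := stat_gap (f := f) (β := β) (σD := σD) (a := a) (b := b) (δ := δ)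
        (M := M) hβ hσD hf hf0 ha hδ hM0 hb
      obtain ⟨d, hd, hgd⟩ := g_gap (M := M) hσD hg hc hcδ
      have hcontk : Continuous (fun t => d / M * max 0 (φ t - (σD + δ))) := by fun_prop
      have hkint : ∀ a b, IntervalIntegrable (fun t => d / M * max 0 (φ t - (σD + δ))) volume a b :=
        fun a b => hcontk.intervalIntegrable _ _
      refine ⟨fun t => (Sfun g σD ν (φ t) - d / M * max 0 (φ t - (σD + δ))) / 3, ?_, ?_, ?_, ?_⟩
      · exact fun t => by simp only [hφper t]
      · exact fun a b => ((hSint a b).sub (hkint a b)).div_const 3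
      · rw [intervalIntegral.integral_div, intervalIntegral.integral_sub (hSint _ _) (hkint _ _)]
        have : 0 < ∫ t in (0:ℝ)..ω, d / M * max 0 (φ t - (σD + δ)) := by
          apply intervalIntegral.integral_pos hω hcontk.continuousOn
          · intro x _
            positivity
          · refine ⟨y, ⟨hy.1, hy.2.le⟩, ?_⟩
            have : 0 < max 0 (φ y - (σD + δ)) := lt_max_of_lt_right (by linarith)
            positivity
        linarith
      · intro t ht
        apply hrate t ht
        rcases le_total (φ t) (σD + δ) with h1 | h1
        · rw [max_eq_left (by linarith), mul_zero, sub_zero]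
          exact hSmono (hσφ t ht.le)
        · rw [max_eq_right (by linarith)]
          obtain ⟨σ', hs⟩ := hstat t ht.le
          have h2 := hgap _ _ _ _ hs (haR t ht.le) (hbR t ht.le) h1 (hM t)
          have h3 := hSmono h2
          have h4 := hgd (φ t) ⟨h1, hM t⟩
          have h5 : Sfun g σD ν (φ t - c) = g (φ t - c) := if_pos (by linarith)
          have h6 : Sfun g σD ν (φ t) = g (φ t) := if_pos (by linarith)
          have h7 : d / M * (φ t - (σD + δ)) ≤ d := by
            rw [div_mul_eq_mul_div, div_le_iff₀ hM0]
            exact mul_le_mul_of_nonneg_left (by linarith [hM t]) hd.le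
          rw [h5] at h3
          rw [h6]
          linarith
    · push Not at hex
      refine ⟨fun _ => -ν / 3, fun _ => rfl, fun a b => by simp, ?_, ?_⟩
      · rw [intervalIntegral.integral_const, smul_eq_mul, sub_zero]
        exact mul_neg_of_pos_of_neg hω (by linarith)
      · intro t ht
        apply hrate t ht
        have := hSmono (hσφ t ht.le)
        rwa [show Sfun g σD ν (φ t) = -ν from if_neg (not_lt.2 (hex t))] at this
  have hT : Tendsto (fun t => ∫ x in (0:ℝ)..t, -ψ x) atTop atTop := by
    apply Function.Periodic.tendsto_atTop_intervalIntegral_of_pos (T := ω)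
    · exact fun t => by simp only [hψper t]
    · rw [intervalIntegral.integral_neg]; linarith
    · exact hω
  obtain ⟨t, ht, hbig⟩ := ((tendsto_atTop.1 hT (Real.log (R 0) - Real.log a + 1)).and
    (eventually_ge_atTop 0)).exists
  rw [intervalIntegral.integral_neg] at ht
  have h1 := log_ineq hpos hder hψint hψle le_rfl hbig
  have h2 := Real.log_le_log ha (haR t hbig)
  linarith
end

section
/- Suppose (A1)–(A3) hold and S̄ > 0. Then there exists a positive ω-time periodic solution (σ_per, R_per) of the evolutionary tumor problem on [0,∞), i.e. a solution with R_per(t + ω) = R_per(t) > 0 and σ_per(r, t + ω) = σ_per(r, t) for all t ≥ 0 and 0 ≤ r ≤ R_per(t). -/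
open MeasureTheory Set Filter Topology

noncomputable def hh (F : ℝ → ℝ) (l w : ℝ) : ℝ := l * F (w / l)

lemma hh_abs {F : ℝ → ℝ} {M : ℝ} (hM : ∀ x, |F x| ≤ M) (l w : ℝ) : |hh F l w| ≤ M * |l| := by
  rw [hh, abs_mul, mul_comm]
  exact mul_le_mul_of_nonneg_right (hM _) (abs_nonneg _)

lemma hh_cont {F : ℝ → ℝ} {M : ℝ} (hF : Continuous F) (hM : ∀ x, |F x| ≤ M) :
    Continuous (fun q : ℝ × ℝ => hh F q.1 q.2) := by
  rw [continuous_iff_continuousAt]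
  rintro ⟨l, w⟩
  by_cases hl : l = 0
  · subst hl
    have h0 : hh F 0 w = 0 := by simp [hh]
    unfold ContinuousAt
    simp only [h0]
    have hb : ∀ q : ℝ × ℝ, ‖hh F q.1 q.2‖ ≤ M * |q.1| := fun q => hh_abs hM _ _
    refine squeeze_zero_norm hb ?_
    have : Continuous (fun q : ℝ × ℝ => M * |q.1|) := by fun_prop
    simpa using this.tendsto ((0 : ℝ), w)
  · unfold hh
    refine ContinuousAt.mul (by fun_prop) ?_
    refine hF.continuousAt.comp ?_
    exact ContinuousAt.div (by fun_prop) (by fun_prop) hl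

lemma hh_cont' {X : Type*} [TopologicalSpace X] {F : ℝ → ℝ} {M : ℝ} (hF : Continuous F)
    (hM : ∀ x, |F x| ≤ M) {a b : X → ℝ} (ha : Continuous a) (hb : Continuous b) :
    Continuous (fun x => hh F (a x) (b x)) :=
  (hh_cont hF hM).comp (ha.prodMk hb)

lemma hh_lip {F : ℝ → ℝ} {K : ℝ} (hK0 : 0 ≤ K) (hK : ∀ x y, |F x - F y| ≤ K * |x - y|) (l w w' : ℝ) :
    |hh F l w - hh F l w'| ≤ K * |w - w'| := by
  by_cases hl : l = 0
  · subst hl; simp [hh]; positivity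
  · unfold hh
    rw [← mul_sub, abs_mul]
    have h1 := hK (w / l) (w' / l)
    have h2 : |w - w'| = |l| * |w / l - w' / l| := by
      rw [← abs_mul]; congr 1; field_simp
    rw [h2]
    calc |l| * _ ≤ |l| * (K * |w / l - w' / l|) := by gcongr
      _ = _ := by ring

lemma hh_mono {F : ℝ → ℝ} (hF : Monotone F) {l w w' : ℝ} (hl : 0 ≤ l) (h : w ≤ w') :
    hh F l w ≤ hh F l w' := by
  unfold hh
  exact mul_le_mul_of_nonneg_left (hF (div_le_div_of_nonneg_right h hl)) hl

lemma cont_int {X : Type*} [TopologicalSpace X] [FirstCountableTopology X] {k : X → ℝ → ℝ}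
    (hk : Continuous (Function.uncurry k)) {a b : X → ℝ} (ha : Continuous a) (hb : Continuous b) :
    Continuous fun x => ∫ l in (a x)..(b x), k x l := by
  have h1 := intervalIntegral.continuous_parametric_intervalIntegral_of_continuous
    (μ := volume) (a₀ := 0) hk ha
  have h2 := intervalIntegral.continuous_parametric_intervalIntegral_of_continuous
    (μ := volume) (a₀ := 0) hk hb
  refine (h2.sub h1).congr fun x => ?_
  have hc : Continuous (k x) := hk.comp (by fun_prop : Continuous fun l => (x, l))
  exact intervalIntegral.integral_interval_sub_left (hc.intervalIntegrable _ _)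
    (hc.intervalIntegrable _ _)

lemma kernel_int {lam ρ Y : ℝ} (hl : 0 < lam) (h : ρ ≤ Y) :
    ∫ l in ρ..Y, (Y - l) * Real.exp (lam * l) ≤ Real.exp (lam * Y) / lam ^ 2 := by
  have hd : ∀ l ∈ uIcc ρ Y, HasDerivAt
      (fun l => ((Y - l) / lam + 1 / lam ^ 2) * Real.exp (lam * l)) ((Y - l) * Real.exp (lam * l)) l := by
    intro l _
    have h1 : HasDerivAt (fun l => (Y - l) / lam + 1 / lam ^ 2) ((-1) / lam) l :=
      (((hasDerivAt_id l).const_sub Y).div_const lam).add_const _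
    have h2 : HasDerivAt (fun l => Real.exp (lam * l)) (Real.exp (lam * l) * (lam * 1)) l :=
      ((hasDerivAt_id l).const_mul lam).exp
    refine (h1.mul h2).congr_deriv ?_
    have : lam ≠ 0 := hl.ne'
    field_simp
    ring
  rw [intervalIntegral.integral_eq_sub_of_hasDerivAt hd
    (by apply Continuous.intervalIntegrable; fun_prop)]
  have : 0 ≤ ((Y - ρ) / lam + 1 / lam ^ 2) * Real.exp (lam * ρ) := by
    have : 0 ≤ Y - ρ := by linarith
    positivity
  have e : ((Y - Y) / lam + 1 / lam ^ 2) * Real.exp (lam * Y) = Real.exp (lam * Y) / lam ^ 2 := by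
    simp; ring
  linarith

lemma kernel_bound {lam ρ Y C : ℝ} (hl : 0 < lam) (h : ρ ≤ Y) (hC : 0 ≤ C) {k : ℝ → ℝ}
    (hb : ∀ l ∈ Icc ρ Y, |k l| ≤ C * Real.exp (lam * l)) :
    |∫ l in ρ..Y, (Y - l) * k l| ≤ C * (Real.exp (lam * Y) / lam ^ 2) := by
  have h1 : |∫ l in ρ..Y, (Y - l) * k l| ≤ ∫ l in ρ..Y, C * ((Y - l) * Real.exp (lam * l)) := by
    rw [← Real.norm_eq_abs]
    refine intervalIntegral.norm_integral_le_of_norm_le h ?_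
      (by apply Continuous.intervalIntegrable; fun_prop)
    refine Eventually.of_forall fun l hl => ?_
    rw [Real.norm_eq_abs, abs_mul, abs_of_nonneg (by linarith [hl.2])]
    have := hb l ⟨hl.1.le, hl.2⟩
    have h3 : 0 ≤ Y - l := by linarith [hl.2]
    calc _ ≤ (Y - l) * (C * Real.exp (lam * l)) := by gcongr
      _ = _ := by ring
  rw [intervalIntegral.integral_const_mul] at h1
  exact h1.trans (mul_le_mul_of_nonneg_left (kernel_int hl h) hC)

noncomputable def rho (p : ℝ) : ℝ := max p 0
noncomputable def aa (D p : ℝ) : ℝ := D + max (-p) 0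

lemma rho_cont : Continuous rho := by unfold rho; fun_prop
lemma aa_cont (D : ℝ) : Continuous (aa D) := by unfold aa; fun_prop
lemma rho_nonneg (p : ℝ) : 0 ≤ rho p := le_max_right _ _
lemma rho_mono : Monotone rho := fun _ _ h => max_le_max h le_rfl
lemma aa_anti (D : ℝ) : Antitone (aa D) := fun _ _ h => by
  unfold aa; gcongr

/-- comparison of the Volterra integrals -/
lemma int_compare {p q r : ℝ} (hpq : p ≤ q) {k k' : ℝ → ℝ} (hk : Continuous k)
    (hk' : Continuous k') (h0 : ∀ l, 0 ≤ l → l ≤ r → 0 ≤ k l)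
    (h : ∀ l, 0 ≤ l → l ≤ r → k' l ≤ k l) :
    ∫ l in (rho q)..(max r (rho q)), k' l ≤ ∫ l in (rho p)..(max r (rho p)), k l := by
  rcases le_or_gt r (rho q) with hr | hr
  · rw [max_eq_right hr, intervalIntegral.integral_same]
    rcases le_or_gt r (rho p) with hr' | hr'
    · rw [max_eq_right hr', intervalIntegral.integral_same]
    · rw [max_eq_left hr'.le]
      exact intervalIntegral.integral_nonneg hr'.le
        fun l hl => h0 l ((rho_nonneg p).trans hl.1) hl.2
  · have hpr : rho p < r := (rho_mono hpq).trans_lt hr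
    rw [max_eq_left hr.le, max_eq_left hpr.le]
    calc _ ≤ ∫ l in (rho q)..r, k l :=
          intervalIntegral.integral_mono_on hr.le (hk'.intervalIntegrable _ _)
            (hk.intervalIntegrable _ _) fun l hl => h l ((rho_nonneg q).trans hl.1) hl.2
      _ ≤ (∫ l in (rho p)..(rho q), k l) + ∫ l in (rho q)..r, k l := by
          have : 0 ≤ ∫ l in (rho p)..(rho q), k l :=
            intervalIntegral.integral_nonneg (rho_mono hpq)
              fun l hl => h0 l ((rho_nonneg p).trans hl.1) (hl.2.trans hr.le)
          linarith
      _ = _ := intervalIntegral.integral_add_adjacent_intervals (hk.intervalIntegrable _ _)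
            (hk.intervalIntegrable _ _)

theorem volterra (D : ℝ) {F : ℝ → ℝ} {K M : ℝ} (hF : Continuous F) (hFm : Monotone F)
    (hK0 : 0 ≤ K) (hK : ∀ x y, |F x - F y| ≤ K * |x - y|) (hM : ∀ x, |F x| ≤ M)
    (hF0 : ∀ x, 0 ≤ F x) :
    ∃ w : ℝ → ℝ → ℝ, Continuous (Function.uncurry w) ∧
      (∀ r p, w r p = aa D p * r +
        ∫ l in (rho p)..(max r (rho p)), (max r (rho p) - l) * hh F l (w l p)) ∧
      (∀ r, 0 ≤ r → Antitone (w r)) := by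
  have hM0 : 0 ≤ M := (abs_nonneg _).trans (hM 0)
  set lam : ℝ := 2 * K + 1 with hlam
  have hl1 : 1 ≤ lam := by linarith
  have hl0 : 0 < lam := by linarith
  have hl2 : 2 * K ≤ lam ^ 2 := by nlinarith
  -- the function w associated with z
  let W : BoundedContinuousFunction (ℝ × ℝ) ℝ → ℝ → ℝ → ℝ := fun z l p =>
    aa D p * l + Real.exp (lam * max l (rho p)) * z (l, p)
  have hWc : ∀ z, Continuous (fun q : ℝ × ℝ => W z q.1 q.2) := by
    intro z
    have := aa_cont D
    have := rho_cont
    have := z.continuous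
    fun_prop
  let Tf : BoundedContinuousFunction (ℝ × ℝ) ℝ → ℝ × ℝ → ℝ := fun z x =>
    Real.exp (-(lam * max x.1 (rho x.2))) *
      ∫ l in (rho x.2)..(max x.1 (rho x.2)), (max x.1 (rho x.2) - l) * hh F l (W z l x.2)
  have hTc : ∀ z, Continuous (Tf z) := by
    intro z
    have h1 := rho_cont
    refine Continuous.mul (by fun_prop) ?_
    refine cont_int (k := fun (x : ℝ × ℝ) l => (max x.1 (rho x.2) - l) * hh F l (W z l x.2))
      ?_ (by fun_prop) (by fun_prop)
    refine Continuous.mul (f := fun y : (ℝ × ℝ) × ℝ => max y.1.1 (rho y.1.2) - y.2)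
      (by fun_prop) ?_
    exact hh_cont' hF hM (by fun_prop)
      ((hWc z).comp (by fun_prop : Continuous fun y : (ℝ × ℝ) × ℝ => (y.2, y.1.2)))
  have hexp : ∀ (C Y I : ℝ), |I| ≤ C * (Real.exp (lam * Y) / lam ^ 2) →
      |Real.exp (-(lam * Y)) * I| ≤ C / lam ^ 2 := by
    intro C Y I hI
    rw [abs_mul, abs_of_pos (Real.exp_pos _)]
    calc _ ≤ Real.exp (-(lam * Y)) * (C * (Real.exp (lam * Y) / lam ^ 2)) := by gcongr
      _ = (Real.exp (-(lam * Y)) * Real.exp (lam * Y)) * (C / lam ^ 2) := by ring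
      _ = _ := by rw [← Real.exp_add]; simp
  have hTb : ∀ z x, ‖Tf z x‖ ≤ M / lam ^ 2 := by
    intro z x
    refine hexp _ _ _ (kernel_bound hl0 (le_max_right _ _) hM0 fun l hl => ?_)
    refine (hh_abs hM _ _).trans ?_
    have hl' : 0 ≤ l := (rho_nonneg _).trans hl.1
    rw [abs_of_nonneg hl']
    have := Real.add_one_le_exp (lam * l)
    have : l ≤ lam * l := by nlinarith
    gcongr
    linarith
  let T : BoundedContinuousFunction (ℝ × ℝ) ℝ → BoundedContinuousFunction (ℝ × ℝ) ℝ := fun z =>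
    BoundedContinuousFunction.ofNormedAddCommGroup (Tf z) (hTc z) _ (hTb z)
  have hTapp : ∀ z x, T z x = Tf z x := fun z x => rfl
  have hcontr : ContractingWith (1 / 2 : NNReal) T := by
    refine ⟨by
      rw [← NNReal.coe_lt_coe]; push_cast; norm_num, LipschitzWith.of_dist_le_mul fun z z' => ?_⟩
    have h12 : (((1 / 2 : NNReal)) : ℝ) = 1 / 2 := by push_cast; norm_num
    rw [h12]
    refine (BoundedContinuousFunction.dist_le (by positivity)).2 fun x => ?_
    rw [hTapp, hTapp, Real.dist_eq]
    have hsub : Tf z x - Tf z' x = Real.exp (-(lam * max x.1 (rho x.2))) *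
      ∫ l in (rho x.2)..(max x.1 (rho x.2)), (max x.1 (rho x.2) - l) *
        (hh F l (W z l x.2) - hh F l (W z' l x.2)) := by
      have hc : ∀ z, Continuous fun l => (max x.1 (rho x.2) - l) * hh F l (W z l x.2) := fun z =>
        Continuous.mul (by fun_prop) (hh_cont' hF hM (by fun_prop)
          ((hWc z).comp (by fun_prop : Continuous fun l : ℝ => (l, x.2))))
      simp only [Tf, mul_sub]
      rw [← mul_sub, ← intervalIntegral.integral_sub ((hc z).intervalIntegrable _ _)
        ((hc z').intervalIntegrable _ _)]
    rw [hsub]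
    refine (hexp (K * dist z z') _ _ (kernel_bound hl0 (le_max_right _ _) (by positivity)
      fun l hl => ?_)).trans ?_
    · refine (hh_lip hK0 hK _ _ _).trans ?_
      have e : W z l x.2 - W z' l x.2 = Real.exp (lam * l) * (z (l, x.2) - z' (l, x.2)) := by
        simp only [W, max_eq_left hl.1]; ring
      rw [e, abs_mul, abs_of_pos (Real.exp_pos _), ← Real.dist_eq]
      have := BoundedContinuousFunction.dist_coe_le_dist (f := z) (g := z') (l, x.2)
      calc _ ≤ K * (Real.exp (lam * l) * dist z z') := by gcongr
        _ = _ := by ring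
    · rw [div_le_iff₀ (by positivity)]
      have : 0 ≤ dist z z' := dist_nonneg
      nlinarith
  let z := hcontr.fixedPoint T
  have hz : T z = z := hcontr.fixedPoint_isFixedPt
  have hWeq : ∀ z r p, W (T z) r p = aa D p * r +
        ∫ l in (rho p)..(max r (rho p)), (max r (rho p) - l) * hh F l (W z l p) := by
    intro z r p
    simp only [W, hTapp, Tf]
    rw [← mul_assoc, ← Real.exp_add]
    simp
  refine ⟨W z, hWc z, fun r p => ?_, ?_⟩
  · conv_lhs => rw [← hz]
    exact hWeq z r p
  · have hit : ∀ n r, 0 ≤ r → Antitone (W (T^[n] 0) r) := by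
      intro n
      induction n with
      | zero =>
        intro r hr p q hpq
        simp only [W, Function.iterate_zero, id]
        simpa using mul_le_mul_of_nonneg_right (aa_anti D hpq) hr
      | succ n ih =>
        intro r hr p q hpq
        rw [Function.iterate_succ_apply', hWeq, hWeq]
        refine add_le_add (mul_le_mul_of_nonneg_right (aa_anti D hpq) hr) ?_
        have hc : ∀ s p, Continuous fun l => (s - l) * hh F l (W (T^[n] 0) l p) := fun s p =>
          Continuous.mul (by fun_prop) (hh_cont' hF hM (by fun_prop)
            ((hWc _).comp (by fun_prop : Continuous fun l : ℝ => (l, p))))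
        have key := int_compare (r := r) hpq (hc r p) (hc r q)
          (fun l hl hlr => mul_nonneg (by linarith) (mul_nonneg hl (hF0 _)))
          (fun l hl hlr => mul_le_mul_of_nonneg_left (hh_mono hFm hl (ih l hl hpq)) (by linarith))
        have hcg : ∀ p, ∫ l in (rho p)..(max r (rho p)),
            (max r (rho p) - l) * hh F l (W (T^[n] 0) l p) =
            ∫ l in (rho p)..(max r (rho p)), (r - l) * hh F l (W (T^[n] 0) l p) := by
          intro p
          rcases le_or_gt r (rho p) with hr | hr
          · rw [max_eq_right hr, intervalIntegral.integral_same, intervalIntegral.integral_same]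
          · rw [max_eq_left hr.le]
        rw [hcg, hcg]
        exact key
    have hlim : ∀ r p, Tendsto (fun n => W (T^[n] 0) r p) atTop (𝓝 (W z r p)) := by
      intro r p
      have h1 := hcontr.tendsto_iterate_fixedPoint (0 : BoundedContinuousFunction (ℝ × ℝ) ℝ)
      have h2 : Tendsto (fun n => (T^[n] 0) (r, p)) atTop (𝓝 (z (r, p))) :=
        ((BoundedContinuousFunction.lipschitz_eval_const (r, p)).continuous.tendsto _).comp h1
      exact tendsto_const_nhds.add (tendsto_const_nhds.mul h2)
    intro r hr p q hpq
    exact le_of_tendsto_of_tendsto' (hlim r q) (hlim r p) fun n => hit n r hr hpq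


structure Vol (D c M : ℝ) (F : ℝ → ℝ) (w : ℝ → ℝ → ℝ) : Prop where
  hD : 0 < D
  hc : 0 < c
  hF : Continuous F
  hFm : Monotone F
  hM : ∀ x, |F x| ≤ M
  hcF : ∀ x, c ≤ F x
  wc : Continuous (Function.uncurry w)
  weq : ∀ r p, w r p = aa D p * r +
        ∫ l in (rho p)..(max r (rho p)), (max r (rho p) - l) * hh F l (w l p)
  wanti : ∀ r, 0 ≤ r → Antitone (w r)

noncomputable def JJ (F : ℝ → ℝ) (w : ℝ → ℝ → ℝ) (r p : ℝ) : ℝ :=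
  ∫ l in (rho p)..(max r (rho p)), l * hh F l (w l p)

noncomputable def Phi (β : ℝ) (F : ℝ → ℝ) (w : ℝ → ℝ → ℝ) (R p : ℝ) : ℝ :=
  w R p / R + JJ F w R p / (β * R ^ 2) - max (p - R) 0

namespace Vol
variable {D c M β : ℝ} {F : ℝ → ℝ} {w : ℝ → ℝ → ℝ}

lemma hM0 (V : Vol D c M F w) : 0 ≤ M := (abs_nonneg _).trans (V.hM 0)

lemma kc (V : Vol D c M F w) {E : ℝ → ℝ} {N : ℝ} (hE : Continuous E) (hN : ∀ x, |E x| ≤ N) (p : ℝ) :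
    Continuous fun l => hh E l (w l p) :=
  hh_cont' hE hN continuous_id (V.wc.comp (by fun_prop : Continuous fun l : ℝ => (l, p)))

lemma lkc (V : Vol D c M F w) {E : ℝ → ℝ} {N : ℝ} (hE : Continuous E) (hN : ∀ x, |E x| ≤ N) (p : ℝ) :
    Continuous fun l => l * hh E l (w l p) := continuous_id.mul (V.kc hE hN p)

lemma JJ_cont (V : Vol D c M F w) {E : ℝ → ℝ} {N : ℝ} (hE : Continuous E) (hN : ∀ x, |E x| ≤ N) :
    Continuous (fun q : ℝ × ℝ => JJ E w q.1 q.2) := by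
  unfold JJ
  have h1 := rho_cont
  refine cont_int (k := fun (x : ℝ × ℝ) l => l * hh E l (w l x.2)) ?_ (by fun_prop) (by fun_prop)
  refine Continuous.mul (f := fun y : (ℝ × ℝ) × ℝ => y.2) (by fun_prop) ?_
  exact hh_cont' hE hN (by fun_prop)
      (V.wc.comp (by fun_prop : Continuous fun y : (ℝ × ℝ) × ℝ => (y.2, y.1.2)))

lemma JJ_zero {E : ℝ → ℝ} {r p : ℝ} (h : r ≤ rho p) : JJ E w r p = 0 := by
  rw [JJ, max_eq_right h, intervalIntegral.integral_same]

lemma JJ_eq {E : ℝ → ℝ} {r p : ℝ} (h : rho p ≤ r) : 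
    JJ E w r p = ∫ l in (rho p)..r, l * hh E l (w l p) := by
  rw [JJ, max_eq_left h]

lemma hh_lower (V : Vol D c M F w) {l : ℝ} (hl : 0 ≤ l) (x : ℝ) : c * l ≤ hh F l x := by
  unfold hh
  rw [mul_comm]
  exact mul_le_mul_of_nonneg_left (V.hcF _) hl

lemma hh_nonneg (V : Vol D c M F w) {l : ℝ} (hl : 0 ≤ l) (x : ℝ) : 0 ≤ hh F l x :=
  (mul_nonneg V.hc.le hl).trans (V.hh_lower hl x)

lemma JJ_anti (V : Vol D c M F w) {r : ℝ} : Antitone (JJ F w r) := by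
  intro p q hpq
  exact int_compare (r := r) hpq (V.lkc V.hF V.hM p) (V.lkc V.hF V.hM q)
    (fun l hl _ => mul_nonneg hl (V.hh_nonneg hl _))
    (fun l hl _ => mul_le_mul_of_nonneg_left (hh_mono V.hFm hl (V.wanti l hl hpq)) hl)

lemma JJ_nonneg (V : Vol D c M F w) (r p : ℝ) : 0 ≤ JJ F w r p :=
  intervalIntegral.integral_nonneg (le_max_right _ _) fun l hl =>
    have h0 : 0 ≤ l := (rho_nonneg p).trans hl.1
    mul_nonneg h0 (V.hh_nonneg h0 _)

lemma JJ_abs {E : ℝ → ℝ} {N : ℝ} (hN : ∀ x, |E x| ≤ N) {r : ℝ} (hr : 0 ≤ r) (p : ℝ) :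
    |JJ E w r p| ≤ N * r ^ 3 := by
  have hN0 : 0 ≤ N := (abs_nonneg _).trans (hN 0)
  rcases le_or_gt r (rho p) with h | h
  · rw [JJ_zero h]; simp; positivity
  · rw [JJ_eq h.le, ← Real.norm_eq_abs]
    have hρ := rho_nonneg p
    refine (intervalIntegral.norm_integral_le_of_norm_le_const (C := N * r ^ 2) ?_).trans ?_
    · intro l hl
      rw [uIoc_of_le h.le] at hl
      have hl0 : 0 ≤ l := hρ.trans hl.1.le
      rw [Real.norm_eq_abs, abs_mul, abs_of_nonneg hl0]
      have := hh_abs hN l (w l p)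
      rw [abs_of_nonneg hl0] at this
      calc _ ≤ l * (N * l) := by gcongr
        _ = N * l ^ 2 := by ring
        _ ≤ _ := by have := hl.2; gcongr
    · rw [abs_of_nonneg (by linarith)]
      calc _ ≤ N * r ^ 2 * r := by gcongr; linarith
        _ = _ := by ring

lemma w_lin (V : Vol D c M F w) {r p : ℝ} (h : r ≤ rho p) : w r p = aa D p * r := by
  rw [V.weq, max_eq_right h, intervalIntegral.integral_same, add_zero]

lemma w_lower (V : Vol D c M F w) (r p : ℝ) : aa D p * r ≤ w r p := by
  rw [V.weq]
  have : 0 ≤ ∫ l in (rho p)..(max r (rho p)), (max r (rho p) - l) * hh F l (w l p) :=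
    intervalIntegral.integral_nonneg (le_max_right _ _) fun l hl =>
      mul_nonneg (by linarith [hl.2]) (V.hh_nonneg ((rho_nonneg p).trans hl.1) _)
  linarith

lemma w_upper (V : Vol D c M F w) {r : ℝ} (hr : 0 ≤ r) (p : ℝ) :
    w r p ≤ aa D p * r + M * r ^ 3 := by
  have hM0 := V.hM0
  rcases le_or_gt r (rho p) with h | h
  · rw [V.w_lin h]
    have : 0 ≤ M * r ^ 3 := by positivity
    linarith
  · rw [V.weq, max_eq_left h.le]
    have hρ := rho_nonneg p
    refine add_le_add le_rfl ((le_abs_self _).trans ?_)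
    rw [← Real.norm_eq_abs]
    refine (intervalIntegral.norm_integral_le_of_norm_le_const (C := M * r ^ 2) ?_).trans ?_
    · intro l hl
      rw [uIoc_of_le h.le] at hl
      have hl0 : 0 ≤ l := hρ.trans hl.1.le
      have h2 := hl.2
      rw [Real.norm_eq_abs, abs_mul, abs_of_nonneg (by linarith : 0 ≤ r - l)]
      have := hh_abs V.hM l (w l p)
      rw [abs_of_nonneg hl0] at this
      calc _ ≤ r * (M * r) := by
            gcongr
            · linarith
            · exact this.trans (by gcongr)
        _ = _ := by ring
    · rw [abs_of_nonneg (by linarith)]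
      calc _ ≤ M * r ^ 2 * r := by gcongr; linarith
        _ = _ := by ring

lemma int_lower (V : Vol D c M F w) {a b p : ℝ} (ha : 0 ≤ a) (hab : a ≤ b) :
    c * (b ^ 3 - a ^ 3) / 3 ≤ ∫ l in a..b, l * hh F l (w l p) := by
  have : ∫ l in a..b, c * l ^ 2 = c * (b ^ 3 - a ^ 3) / 3 := by
    rw [intervalIntegral.integral_const_mul, integral_pow]; norm_num; ring
  rw [← this]
  refine intervalIntegral.integral_mono_on hab (by apply Continuous.intervalIntegrable; fun_prop)
    ((V.lkc V.hF V.hM p).intervalIntegrable _ _) fun l hl => ?_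
  have hl0 : 0 ≤ l := ha.trans hl.1
  have := V.hh_lower hl0 (w l p)
  nlinarith

lemma Phi_ge (V : Vol D c M F w) {R p : ℝ} (hR : 0 < R) (h : R ≤ p) :
    Phi β F w R p = D - (p - R) := by
  have hp : rho p = p := max_eq_left (hR.le.trans h)
  rw [Phi, JJ_zero (by rw [hp]; exact h), V.w_lin (by rw [hp]; exact h),
    max_eq_left (by linarith), aa, max_eq_right (by linarith)]
  field_simp
  ring

lemma Phi_strict (V : Vol D c M F w) (hβ : 0 < β) {R : ℝ} (hR : 0 < R) :
    StrictAnti (Phi β F w R) := by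
  intro p q hpq
  have hw := V.wanti R hR.le hpq.le
  have hJ := V.JJ_anti (r := R) hpq.le
  have hm : max (p - R) 0 ≤ max (q - R) 0 := max_le_max (by linarith) le_rfl
  have hw' : w R q / R ≤ w R p / R := by gcongr
  have hJ' : JJ F w R q / (β * R ^ 2) ≤ JJ F w R p / (β * R ^ 2) := by gcongr
  unfold Phi
  rcases lt_or_ge R q with hq | hq
  · have : max (p - R) 0 < max (q - R) 0 := by
      rw [max_eq_left (by linarith : 0 ≤ q - R)]
      exact max_lt (by linarith) (by linarith)
    linarith
  rcases lt_or_ge p 0 with hp | hp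
  · have ha : aa D q < aa D p := by
      unfold aa
      rw [max_eq_left (by linarith : 0 ≤ -p)]
      have := max_lt (by linarith : -q < -p) (by linarith : 0 < -p)
      linarith
    have : w R q < w R p := by
      have hqR : rho q ≤ R := max_le hq hR.le
      have hpR : rho p ≤ R := (rho_mono hpq.le).trans hqR
      rw [V.weq R q, V.weq R p]
      have key := int_compare (r := R) hpq.le
        (k := fun l => (R - l) * hh F l (w l p)) (k' := fun l => (R - l) * hh F l (w l q))
        (Continuous.mul (by fun_prop) (V.kc V.hF V.hM p))
        (Continuous.mul (by fun_prop) (V.kc V.hF V.hM q))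
        (fun l hl hlr => mul_nonneg (by linarith) (V.hh_nonneg hl _))
        (fun l hl hlr => mul_le_mul_of_nonneg_left
          (hh_mono V.hFm hl (V.wanti l hl hpq.le)) (by linarith))
      rw [max_eq_left hqR, max_eq_left hpR] at key ⊢
      have := mul_lt_mul_of_pos_right ha hR
      linarith
    have : w R q / R < w R p / R := by gcongr
    linarith
  · have hpe : rho p = p := max_eq_left hp
    have hqe : rho q = q := max_eq_left (hp.trans hpq.le)
    have : JJ F w R q < JJ F w R p := by
      rw [JJ_eq (by rw [hqe]; exact hq), JJ_eq (by rw [hpe]; linarith), hpe, hqe,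
        ← intervalIntegral.integral_add_adjacent_intervals
          ((V.lkc V.hF V.hM p).intervalIntegrable p q) ((V.lkc V.hF V.hM p).intervalIntegrable q R)]
      have h1 := V.int_lower (p := p) hp hpq.le
      have h2 : 0 < c * (q ^ 3 - p ^ 3) / 3 := by
        have := pow_lt_pow_left₀ hpq hp (by norm_num : (3 : ℕ) ≠ 0)
        have := V.hc
        have : 0 < q ^ 3 - p ^ 3 := by linarith
        positivity
      have h3 : ∫ l in q..R, l * hh F l (w l q) ≤ ∫ l in q..R, l * hh F l (w l p) :=
        intervalIntegral.integral_mono_on hq ((V.lkc V.hF V.hM q).intervalIntegrable _ _)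
          ((V.lkc V.hF V.hM p).intervalIntegrable _ _) fun l hl => by
            have hl0 : 0 ≤ l := by linarith [hl.1]
            exact mul_le_mul_of_nonneg_left (hh_mono V.hFm hl0 (V.wanti l hl0 hpq.le)) hl0
      linarith
    have : JJ F w R q / (β * R ^ 2) < JJ F w R p / (β * R ^ 2) := by gcongr
    linarith

lemma Phi_contAt (V : Vol D c M F w) (hβ : 0 < β) {R : ℝ} (hR : 0 < R) (p : ℝ) :
    ContinuousAt (fun q : ℝ × ℝ => Phi β F w q.1 q.2) (R, p) := by
  unfold Phi
  have h1 : ContinuousAt (fun q : ℝ × ℝ => w q.1 q.2) (R, p) := V.wc.continuousAt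
  have h2 := (V.JJ_cont V.hF V.hM).continuousAt (x := (R, p))
  refine ((h1.div (by fun_prop) hR.ne').add (h2.div (by fun_prop) ?_)).sub (by fun_prop)
  simp; exact ⟨hβ.ne', hR.ne'⟩

lemma exists_P (V : Vol D c M F w) (hβ : 0 < β) : ∃ P : ℝ → ℝ → ℝ,
    (∀ s R, 0 < R → Phi β F w R (P s R) = s) ∧
    (∀ s R, 0 < R → ContinuousAt (fun q : ℝ × ℝ => P q.1 q.2) (s, R)) := by
  have hex : ∀ s R, ∃ p, 0 < R → Phi β F w R p = s := by
    intro s R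
    by_cases hR : 0 < R
    · rcases le_or_gt s D with hs | hs
      · refine ⟨R + (D - s), fun _ => ?_⟩
        rw [V.Phi_ge hR (by linarith)]; ring
      · have hc : ContinuousOn (Phi β F w R) (Icc (D - s) R) := by
          intro p _
          exact ((V.Phi_contAt hβ hR p).comp (f := fun p : ℝ => (R, p))
            (by fun_prop)).continuousWithinAt
        have h1 : s ≤ Phi β F w R (D - s) := by
          unfold Phi
          have h2 := V.w_lower R (D - s)
          have h3 : aa D (D - s) = s := by
            unfold aa; rw [max_eq_left (by linarith)]; ring
          rw [h3] at h2
          have h4 : s ≤ w R (D - s) / R := by rwa [le_div_iff₀ hR]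
          have h5 : 0 ≤ JJ F w R (D - s) / (β * R ^ 2) :=
            div_nonneg (V.JJ_nonneg _ _) (by positivity)
          rw [max_eq_right (by linarith)]
          linarith
        have h2 : Phi β F w R R ≤ s := by
          rw [V.Phi_ge hR le_rfl]; linarith
        obtain ⟨p, _, hp⟩ := intermediate_value_Icc' (by linarith) hc ⟨h2, h1⟩
        exact ⟨p, fun _ => hp⟩
    · exact ⟨0, fun h => absurd h hR⟩
  choose P hP using hex
  refine ⟨P, hP, fun s R hR => ?_⟩
  have hev : ∀ᶠ q : ℝ × ℝ in 𝓝 (s, R), 0 < q.2 :=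
    (continuous_snd.tendsto (s, R)).eventually (lt_mem_nhds hR)
  have hcomp : ∀ p, ContinuousAt (fun q : ℝ × ℝ => Phi β F w q.2 p - q.1) (s, R) := fun p =>
    ContinuousAt.sub (ContinuousAt.comp (f := fun q : ℝ × ℝ => (q.2, p)) (x := (s, R))
      (V.Phi_contAt hβ hR p) (by fun_prop)) (by fun_prop)
  rw [ContinuousAt, tendsto_order]
  constructor
  · intro a ha
    have h1 : 0 < Phi β F w R a - s := by
      have := V.Phi_strict hβ hR ha
      rw [hP s R hR] at this; linarith
    filter_upwards [hev, (hcomp a).eventually (lt_mem_nhds h1)] with q hq hq'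
    rw [← (V.Phi_strict hβ hq).lt_iff_gt, hP _ _ hq]; linarith
  · intro a ha
    have h1 : Phi β F w R a - s < 0 := by
      have := V.Phi_strict hβ hR ha
      rw [hP s R hR] at this; linarith
    filter_upwards [hev, (hcomp a).eventually (gt_mem_nhds h1)] with q hq hq'
    rw [← (V.Phi_strict hβ hq).lt_iff_gt, hP _ _ hq]; linarith

end Vol


noncomputable def GG (ν : ℝ) (E : ℝ → ℝ) (w P : ℝ → ℝ → ℝ) (s R : ℝ) : ℝ :=
  (-ν * (min (rho (P s R)) R) ^ 3 / 3 + JJ E w R (P s R)) / R ^ 3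

namespace Vol
variable {D c M β ν N : ℝ} {F E : ℝ → ℝ} {w P : ℝ → ℝ → ℝ}

lemma GG_cont (V : Vol D c M F w) (hE : Continuous E) (hN : ∀ x, |E x| ≤ N)
    (hPc : ∀ s R, 0 < R → ContinuousAt (fun q : ℝ × ℝ => P q.1 q.2) (s, R))
    {s R : ℝ} (hR : 0 < R) : ContinuousAt (fun q : ℝ × ℝ => GG ν E w P q.1 q.2) (s, R) := by
  unfold GG
  have h1 := hPc s R hR
  have h2 : ContinuousAt (fun q : ℝ × ℝ => rho (P q.1 q.2)) (s, R) :=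
    ContinuousAt.comp (g := rho) rho_cont.continuousAt h1
  have h3 : ContinuousAt (fun q : ℝ × ℝ => JJ E w q.2 (P q.1 q.2)) (s, R) :=
    ContinuousAt.comp (f := fun q : ℝ × ℝ => (q.2, P q.1 q.2)) (x := (s, R))
      (g := fun q : ℝ × ℝ => JJ E w q.1 q.2)
      (V.JJ_cont hE hN).continuousAt (ContinuousAt.prodMk continuousAt_snd h1)
  refine ContinuousAt.div (ContinuousAt.add ?_ h3) (by fun_prop) (by positivity)
  exact (continuousAt_const.mul ((h2.min continuousAt_snd).pow 3)).div_const _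

lemma GG_abs (hν : 0 < ν) (hN : ∀ x, |E x| ≤ N) {s R : ℝ} (hR : 0 < R) :
    |GG ν E w P s R| ≤ ν + N := by
  unfold GG
  rw [abs_div, abs_of_pos (by positivity : 0 < R ^ 3), div_le_iff₀ (by positivity)]
  have h1 := JJ_abs (w := w) hN hR.le (P s R)
  have h0 : 0 ≤ min (rho (P s R)) R := le_min (rho_nonneg _) hR.le
  have h2 : (min (rho (P s R)) R) ^ 3 ≤ R ^ 3 := by
    gcongr; exact min_le_right _ _
  have h3 : |-ν * (min (rho (P s R)) R) ^ 3 / 3| ≤ ν * R ^ 3 := by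
    rw [neg_mul, neg_div, abs_neg, abs_of_nonneg (by positivity)]
    have : 0 ≤ (min (rho (P s R)) R) ^ 3 := by positivity
    nlinarith
  calc _ ≤ _ := abs_add_le _ _
    _ ≤ ν * R ^ 3 + N * R ^ 3 := add_le_add h3 h1
    _ = _ := by ring

lemma P_ge (V : Vol D c M F w) (hβ : 0 < β) (hP : ∀ s R, 0 < R → Phi β F w R (P s R) = s)
    {s R : ℝ} (hR : 0 < R) (hs : s ≤ D) : R ≤ P s R := by
  rw [← (V.Phi_strict hβ hR).le_iff_ge, hP s R hR, V.Phi_ge hR le_rfl]; linarith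

lemma P_lt (V : Vol D c M F w) (hβ : 0 < β) (hP : ∀ s R, 0 < R → Phi β F w R (P s R) = s)
    {s R : ℝ} (hR : 0 < R) (hs : D < s) : P s R < R := by
  rw [← (V.Phi_strict hβ hR).lt_iff_gt, hP s R hR, V.Phi_ge hR le_rfl]; linarith

lemma GG_low (V : Vol D c M F w) (hβ : 0 < β) (hP : ∀ s R, 0 < R → Phi β F w R (P s R) = s)
    {s R : ℝ} (hR : 0 < R) (hs : s ≤ D) : GG ν E w P s R = -ν / 3 := by
  have h1 : R ≤ rho (P s R) := (V.P_ge hβ hP hR hs).trans (le_max_left _ _)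
  rw [GG, JJ_zero h1, min_eq_right h1]
  field_simp
  ring

lemma aa_ge {p : ℝ} : D ≤ aa D p := by
  unfold aa; linarith [le_max_right (-p) 0]

lemma GG_neg (V : Vol D c M F w) (hβ : 0 < β) (hν : 0 < ν)
    (hP : ∀ s R, 0 < R → Phi β F w R (P s R) = s) (hE : Continuous E) (hN : ∀ x, |E x| ≤ N)
    {smax : ℝ} : ∃ R0 > 0, ∀ s ≤ smax, ∀ R ≥ R0, GG ν E w P s R ≤ 0 := by
  have hc := V.hc
  have hN0 : 0 ≤ N := (abs_nonneg _).trans (hN 0)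
  set A := max (smax - D) 0 with hA
  have hA0 : 0 ≤ A := le_max_right _ _
  refine ⟨3 * (ν + N) * β * A / (c * ν) + 1, by positivity, fun s hs R hR => ?_⟩
  have hR0 : 0 < R := lt_of_lt_of_le (by positivity) hR
  rcases le_or_gt s D with hsD | hsD
  · rw [V.GG_low hβ hP hR0 hsD]; linarith
  have hp := V.P_lt hβ hP hR0 hsD
  have hPs := hP s R hR0
  have hρ : rho (P s R) < R := max_lt hp hR0
  set p := P s R with hpd
  have hJ : JJ F w R p ≤ β * R ^ 2 * A := by
    unfold Phi at hPs
    rw [max_eq_right (by linarith)] at hPs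
    have h1 : D ≤ w R p / R := by
      rw [le_div_iff₀ hR0]
      exact (mul_le_mul_of_nonneg_right aa_ge hR0.le).trans (V.w_lower R p)
    have h2 : JJ F w R p / (β * R ^ 2) ≤ A := by
      have := le_max_left (smax - D) 0
      linarith
    rw [div_le_iff₀ (by positivity)] at h2
    linarith
  have h1 : c * (R ^ 3 - rho p ^ 3) / 3 ≤ JJ F w R p := by
    rw [JJ_eq hρ.le]; exact V.int_lower (rho_nonneg _) hρ.le
  have h2 : JJ E w R p ≤ N / c * JJ F w R p := by
    rw [JJ_eq hρ.le, JJ_eq hρ.le, ← intervalIntegral.integral_const_mul]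
    refine intervalIntegral.integral_mono_on hρ.le ((V.lkc hE hN p).intervalIntegrable _ _)
      (((V.lkc V.hF V.hM p).const_mul _).intervalIntegrable _ _) fun l hl => ?_
    have hl0 : 0 ≤ l := (rho_nonneg _).trans hl.1
    have h3 := hh_abs hN l (w l p)
    rw [abs_of_nonneg hl0] at h3
    have h4 := V.hh_lower hl0 (w l p)
    have h5 : hh E l (w l p) ≤ N / c * hh F l (w l p) := by
      calc _ ≤ N * l := (le_abs_self _).trans h3
        _ = N / c * (c * l) := by field_simp
        _ ≤ _ := by gcongr
    calc _ ≤ l * (N / c * hh F l (w l p)) := by gcongr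
      _ = _ := by ring
  unfold GG
  rw [← hpd, min_eq_left hρ.le]
  refine div_nonpos_of_nonpos_of_nonneg ?_ (by positivity)
  have h6 : 3 * (ν + N) * β * A / (c * ν) ≤ R := by linarith
  rw [div_le_iff₀ (by positivity)] at h6
  have h7 : -ν * rho p ^ 3 / 3 ≤ -ν * R ^ 3 / 3 + ν / c * JJ F w R p := by
    have : ν / c * (c * (R ^ 3 - rho p ^ 3) / 3) ≤ ν / c * JJ F w R p := by gcongr
    have e : ν / c * (c * (R ^ 3 - rho p ^ 3) / 3) = ν * (R ^ 3 - rho p ^ 3) / 3 := by field_simp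
    rw [e] at this
    linarith
  have h8 : (ν / c + N / c) * JJ F w R p ≤ (ν / c + N / c) * (β * R ^ 2 * A) := by gcongr
  have h9 : (ν / c + N / c) * (β * R ^ 2 * A) ≤ ν * R ^ 3 / 3 := by
    have : (ν / c + N / c) * (β * R ^ 2 * A) = (3 * (ν + N) * β * A) * R ^ 2 / (3 * c) := by
      field_simp
    rw [this, div_le_div_iff₀ (by positivity) (by positivity)]
    have := mul_le_mul_of_nonneg_right h6 (by positivity : 0 ≤ R ^ 2)
    nlinarith
  linarith

lemma GG_lim (V : Vol D c M F w) (hβ : 0 < β)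
    (hP : ∀ s R, 0 < R → Phi β F w R (P s R) = s) (hE : Continuous E) (hN : ∀ x, |E x| ≤ N)
    {s : ℝ} (hs : D < s) : Tendsto (fun R => GG ν E w P s R) (𝓝[>] 0) (𝓝 (E s / 3)) := by
  have hM0 := V.hM0
  rw [Metric.tendsto_nhds]
  intro ε hε
  obtain ⟨δ, hδ, hd⟩ := Metric.continuousAt_iff.1 (hE.continuousAt (x := s)) (ε / 2) (by positivity)
  have hq : Tendsto (fun R : ℝ => M * R ^ 2 + M * R / β) (𝓝[>] 0) (𝓝 0) := by
    have : Continuous (fun R : ℝ => M * R ^ 2 + M * R / β) := by fun_prop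
    simpa using (this.tendsto 0).mono_left nhdsWithin_le_nhds
  filter_upwards [self_mem_nhdsWithin, hq.eventually (gt_mem_nhds (lt_min hδ (sub_pos.2 hs)))]
    with R hR hq
  have hR : 0 < R := hR
  have hq1 := hq.trans_le (min_le_left _ _)
  have hq2 := hq.trans_le (min_le_right _ _)
  have hJb : ∀ p, JJ F w R p / (β * R ^ 2) ≤ M * R / β := by
    intro p
    rw [div_le_div_iff₀ (by positivity) hβ]
    have := (le_abs_self _).trans (JJ_abs (w := w) V.hM hR.le p)
    nlinarith
  have hwb : ∀ l p, 0 < l → w l p / l ≤ aa D p + M * l ^ 2 := by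
    intro l p hl
    rw [div_le_iff₀ hl]
    have := V.w_upper hl.le p
    nlinarith
  have hwl : ∀ l p, 0 < l → aa D p ≤ w l p / l := by
    intro l p hl
    rw [le_div_iff₀ hl]
    exact V.w_lower l p
  have hPs := hP s R hR
  have hp : P s R < 0 := by
    rw [← (V.Phi_strict hβ hR).lt_iff_gt, hPs]
    unfold Phi
    have h1 := hJb 0
    have h2 := hwb R 0 hR
    rw [max_eq_right (by linarith)]
    have h3 : aa D 0 = D := by simp [aa]
    linarith
  set p := P s R with hpd
  have hρ : rho p = 0 := max_eq_right hp.le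
  have hclose : ∀ l ∈ Ioc 0 R, |E (w l p / l) - E s| ≤ ε / 2 := by
    intro l hl
    have := hd (x := w l p / l) (by
      rw [Real.dist_eq, abs_lt]
      unfold Phi at hPs
      rw [max_eq_right (by linarith)] at hPs
      have h1 := hJb p
      have h2 := hwb R p hR
      have h3 := hwl R p hR
      have h4 := hwb l p hl.1
      have h5 := hwl l p hl.1
      have h6 : 0 ≤ JJ F w R p / (β * R ^ 2) := div_nonneg (V.JJ_nonneg _ _) (by positivity)
      have h7 : M * l ^ 2 ≤ M * R ^ 2 := by
        have := hl.2
        have := hl.1.le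
        gcongr
      have h8 : 0 ≤ M * R / β := by positivity
      constructor <;> linarith)
    rw [Real.dist_eq] at this
    exact this.le
  rw [Real.dist_eq]
  have e : GG ν E w P s R - E s / 3 = (∫ l in (0 : ℝ)..R, (l * hh E l (w l p) - E s * l ^ 2)) / R ^ 3 := by
    have e2 : ∫ l in (0 : ℝ)..R, E s * l ^ 2 = E s * R ^ 3 / 3 := by
      rw [intervalIntegral.integral_const_mul, integral_pow]; norm_num; ring
    rw [intervalIntegral.integral_sub ((V.lkc hE hN p).intervalIntegrable _ _)
      (by apply Continuous.intervalIntegrable; fun_prop), e2]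
    unfold GG
    rw [← hpd, JJ_eq (by rw [hρ]; exact hR.le), hρ, min_eq_left hR.le]
    field_simp
    ring
  rw [e, abs_div, abs_of_pos (by positivity : 0 < R ^ 3), div_lt_iff₀ (by positivity)]
  have : ‖∫ l in (0 : ℝ)..R, (l * hh E l (w l p) - E s * l ^ 2)‖ ≤ (ε / 2 * R ^ 2) * |R - 0| := by
    refine intervalIntegral.norm_integral_le_of_norm_le_const fun l hl => ?_
    rw [uIoc_of_le hR.le] at hl
    have h1 : l * hh E l (w l p) - E s * l ^ 2 = l ^ 2 * (E (w l p / l) - E s) := by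
      unfold hh; ring
    rw [h1, Real.norm_eq_abs, abs_mul, abs_of_nonneg (by positivity), mul_comm]
    have := hclose l hl
    have h3 := hl.2
    have h4 := hl.1.le
    gcongr
  rw [sub_zero, abs_of_pos hR, Real.norm_eq_abs] at this
  have h3 : 0 < ε * R ^ 3 := by positivity
  nlinarith

end Vol


lemma hasDerivAt_comp_max {E E' : ℝ → ℝ} {ρ : ℝ} (hE : ∀ y, HasDerivAt E (E' y) y) (h0 : E' ρ = 0)
    (r : ℝ) : HasDerivAt (fun r => E (max r ρ)) (E' (max r ρ)) r := by
  rcases lt_trichotomy r ρ with h | h | h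
  · rw [max_eq_right h.le, h0]
    refine (hasDerivAt_const r (E ρ)).congr_of_eventuallyEq ?_
    filter_upwards [gt_mem_nhds h] with x hx
    rw [max_eq_right hx.le]
  · subst h
    rw [max_self, h0]
    have h1 : HasDerivWithinAt (fun x => E (max x r)) 0 (Iic r) r :=
      (hasDerivWithinAt_const r (Iic r) (E r)).congr (fun x hx => by rw [max_eq_right hx])
        (by rw [max_self])
    have h2 : HasDerivWithinAt (fun x => E (max x r)) 0 (Ici r) r := by
      have := (hE r).hasDerivWithinAt (s := Ici r)
      rw [h0] at this
      exact this.congr (fun x hx => by rw [max_eq_left hx]) (by rw [max_self])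
    have := h1.union h2
    rwa [Iic_union_Ici, hasDerivWithinAt_univ] at this
  · rw [max_eq_left h.le]
    refine (hE r).congr_of_eventuallyEq ?_
    filter_upwards [lt_mem_nhds h] with x hx
    rw [max_eq_left hx.le]

lemma int_split {Q A B : ℝ → ℝ} {ρ r : ℝ} (h0 : 0 ≤ ρ) (hr : ρ ≤ r) (hA : Continuous A)
    (hB : Continuous B) (h1 : ∀ l ∈ Ioc 0 ρ, Q l = A l) (h2 : ∀ l ∈ Ioc ρ r, Q l = B l) :
    ∫ l in (0 : ℝ)..r, Q l = (∫ l in (0 : ℝ)..ρ, A l) + ∫ l in ρ..r, B l := by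
  have i1 : IntervalIntegrable Q volume 0 ρ :=
    (hA.intervalIntegrable 0 ρ).congr (fun l hl => by
      rw [uIoc_of_le h0] at hl; exact (h1 l hl).symm)
  have i2 : IntervalIntegrable Q volume ρ r :=
    (hB.intervalIntegrable ρ r).congr (fun l hl => by
      rw [uIoc_of_le hr] at hl; exact (h2 l hl).symm)
  rw [← intervalIntegral.integral_add_adjacent_intervals i1 i2]
  congr 1
  · exact intervalIntegral.integral_congr_ae (Eventually.of_forall fun l hl => by
      rw [uIoc_of_le h0] at hl; exact h1 l hl)
  · exact intervalIntegral.integral_congr_ae (Eventually.of_forall fun l hl => by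
      rw [uIoc_of_le hr] at hl; exact h2 l hl)

noncomputable def sg (D : ℝ) (w : ℝ → ℝ → ℝ) (p r : ℝ) : ℝ :=
  if r = 0 then aa D p else w r p / r

namespace Vol
variable {D c M β ν N : ℝ} {F E f g : ℝ → ℝ} {w P : ℝ → ℝ → ℝ}

lemma w_deriv (V : Vol D c M F w) (r p : ℝ) :
    HasDerivAt (fun r => w r p)
      (aa D p + ∫ l in (rho p)..(max r (rho p)), hh F l (w l p)) r := by
  have hk := V.kc V.hF V.hM p
  have hlk := V.lkc V.hF V.hM p
  have hE : ∀ y, HasDerivAt (fun y => y * (∫ l in (rho p)..y, hh F l (w l p)) -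
      ∫ l in (rho p)..y, l * hh F l (w l p)) (∫ l in (rho p)..y, hh F l (w l p)) y := by
    intro y
    have h1 := (hasDerivAt_id y).mul (hk.integral_hasStrictDerivAt (rho p) y).hasDerivAt
    have h2 := (hlk.integral_hasStrictDerivAt (rho p) y).hasDerivAt
    refine (h1.sub h2).congr_deriv ?_
    simp
  have h := hasDerivAt_comp_max (E' := fun y => ∫ l in (rho p)..y, hh F l (w l p)) (ρ := rho p)
    hE (by simp) r
  have h2 := ((hasDerivAt_id r).const_mul (aa D p)).add h
  rw [mul_one] at h2
  refine h2.congr_of_eventuallyEq (Eventually.of_forall fun x => ?_)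
  simp only [Pi.add_apply, id]
  rw [V.weq]
  congr 1
  simp_rw [sub_mul]
  rw [intervalIntegral.integral_sub ((hk.const_mul _).intervalIntegrable _ _)
    (hlk.intervalIntegrable _ _), intervalIntegral.integral_const_mul]

lemma q_deriv (V : Vol D c M F w) {r : ℝ} (hr : 0 < r) (p : ℝ) :
    HasDerivAt (fun r => w r p / r) (JJ F w r p / r ^ 2) r := by
  refine ((V.w_deriv r p).div (hasDerivAt_id r) hr.ne').congr_deriv ?_
  simp only [id]
  congr 1
  have hk := V.kc V.hF V.hM p
  have hlk := V.lkc V.hF V.hM p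
  rcases le_or_gt r (rho p) with h | h
  · rw [V.w_lin h, JJ_zero h, max_eq_right h, intervalIntegral.integral_same]; ring
  · rw [V.weq, JJ_eq h.le, max_eq_left h.le]
    simp_rw [sub_mul]
    rw [intervalIntegral.integral_sub ((hk.const_mul _).intervalIntegrable _ _)
      (hlk.intervalIntegrable _ _), intervalIntegral.integral_const_mul]
    ring

lemma q_mono (V : Vol D c M F w) (p : ℝ) : MonotoneOn (fun r => w r p / r) (Ioi 0) := by
  refine monotoneOn_of_deriv_nonneg (convex_Ioi 0)
    (fun r hr => (V.q_deriv hr p).continuousAt.continuousWithinAt)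
    (fun r hr => (V.q_deriv (by simpa using hr) p).differentiableAt.differentiableWithinAt)
    (fun r hr => ?_)
  have hr : 0 < r := by simpa using hr
  rw [(V.q_deriv hr p).deriv]
  exact div_nonneg (V.JJ_nonneg _ _) (by positivity)

lemma w_strict (V : Vol D c M F w) {l p : ℝ} (h : rho p < l) : D * l < w l p := by
  have h0 := rho_nonneg p
  have hl : 0 < l := h0.trans_lt h
  rw [V.weq, max_eq_left h.le]
  have h1 : D * l ≤ aa D p * l := mul_le_mul_of_nonneg_right aa_ge hl.le
  have h2 : 0 < ∫ t in (rho p)..l, (l - t) * hh F t (w t p) := by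
    refine intervalIntegral.intervalIntegral_pos_of_pos_on
      ((Continuous.mul (by fun_prop) (V.kc V.hF V.hM p)).intervalIntegrable _ _) (fun t ht => ?_) h
    have ht0 : 0 < t := h0.trans_lt ht.1
    exact mul_pos (by linarith [ht.2])
      (lt_of_lt_of_le (mul_pos V.hc ht0) (V.hh_lower ht0.le _))
  linarith

lemma sg_core (V : Vol D c M F w) {l p : ℝ} (hl : 0 < l) (h : l ≤ rho p) : sg D w p l = D := by
  rw [sg, if_neg hl.ne', V.w_lin h, mul_div_assoc, div_self hl.ne', mul_one]
  have : 0 < p := by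
    by_contra hp
    have : rho p = 0 := max_eq_right (not_lt.1 hp)
    linarith
  rw [aa, max_eq_right (by linarith), add_zero]

lemma sg_bounds (V : Vol D c M F w) (hβ : 0 < β)
    (hP : ∀ s R, 0 < R → Phi β F w R (P s R) = s) {s R l : ℝ} (hR : 0 < R) (hs : D < s)
    (hl : rho (P s R) < l) (hlR : l ≤ R) : D < sg D w (P s R) l ∧ sg D w (P s R) l ≤ s := by
  have hl0 : 0 < l := (rho_nonneg _).trans_lt hl
  have hp := V.P_lt hβ hP hR hs
  rw [sg, if_neg hl0.ne']
  constructor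
  · rw [lt_div_iff₀ hl0]; exact V.w_strict hl
  · refine (V.q_mono (P s R) hl0 hR hlR).trans ?_
    have h := hP s R hR
    unfold Phi at h
    rw [max_eq_right (by linarith)] at h
    have h5 : 0 ≤ JJ F w R (P s R) / (β * R ^ 2) :=
            div_nonneg (V.JJ_nonneg _ _) (by positivity)
    dsimp only
    linarith

lemma stationary (V : Vol D c M F w) (hβ : 0 < β)
    (hP : ∀ s R, 0 < R → Phi β F w R (P s R) = s) (hFf : ∀ x ∈ Icc D N, F x = f x)
    {s R : ℝ} (hR : 0 < R) (hs : D < s) (hsN : s ≤ N) :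
    IsStationarySol f β D s R (sg D w (P s R)) (fun r => JJ F w r (P s R) / r ^ 2) := by
  have hp := V.P_lt hβ hP hR hs
  have hPs := hP s R hR
  have hb := fun l => V.sg_bounds hβ hP (l := l) hR hs
  set p := P s R with hpd
  have hρ : rho p < R := max_lt hp hR
  have hd : ∀ r, 0 < r → HasDerivAt (sg D w p) (JJ F w r p / r ^ 2) r := by
    intro r hr
    refine (V.q_deriv hr p).congr_of_eventuallyEq ?_
    filter_upwards [lt_mem_nhds hr] with x hx
    rw [sg, if_neg hx.ne']
  constructor
  · intro r hr
    rcases eq_or_lt_of_le hr.1 with h | h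
    · subst h
      have e0 : sg D w p 0 = aa D p := by simp [sg]
      rw [ContinuousWithinAt, e0]
      have hu : Tendsto (fun r : ℝ => aa D p + M * r ^ 2) (𝓝[Icc 0 R] 0) (𝓝 (aa D p)) := by
        have : Continuous (fun r : ℝ => aa D p + M * r ^ 2) := by fun_prop
        simpa using (this.tendsto 0).mono_left (nhdsWithin_le_nhds (s := Icc 0 R))
      refine tendsto_of_tendsto_of_tendsto_of_le_of_le' tendsto_const_nhds hu ?_ ?_
      · filter_upwards [self_mem_nhdsWithin] with x hx
        rcases eq_or_lt_of_le hx.1 with h | h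
        · rw [← h, e0]
        · rw [sg, if_neg h.ne', le_div_iff₀ h]
          exact V.w_lower _ _
      · filter_upwards [self_mem_nhdsWithin] with x hx
        rcases eq_or_lt_of_le hx.1 with h | h
        · rw [← h, e0]; simp
        · rw [sg, if_neg h.ne', div_le_iff₀ h]
          have := V.w_upper h.le p
          nlinarith
    · exact (hd r h).continuousAt.continuousWithinAt
  · intro r hr
    exact (hd r hr.1).hasDerivWithinAt
  · intro r hr
    have hr0 := hr.1
    have e : r ^ 2 * (JJ F w r p / r ^ 2) = JJ F w r p := by field_simp
    rw [e]
    have hcore : ∀ l ∈ Ioc 0 (rho p), l ^ 2 * f (sg D w p l) * Hside (sg D w p l - D) = 0 := by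
      intro l hl
      rw [V.sg_core hl.1 hl.2]; simp [Hside]
    rcases le_or_gt r (rho p) with h | h
    · rw [JJ_zero h, int_split (A := fun _ => 0) (B := fun _ => 0) hr0.le le_rfl continuous_const
        continuous_const (fun l hl => hcore l ⟨hl.1, hl.2.trans h⟩) (fun l hl => by
          exact absurd (hl.1.trans_le hl.2) (lt_irrefl _))]
      simp
    · rw [JJ_eq h.le, int_split (rho_nonneg p) h.le continuous_const (V.lkc V.hF V.hM p) hcore
        (fun l hl => ?_)]
      · simp
      · have hb := hb l hl.1 (hl.2.trans hr.2)
        have hl0 : 0 < l := (rho_nonneg p).trans_lt hl.1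
        rw [← hFf _ ⟨hb.1.le, hb.2.trans hsN⟩, Hside, if_pos (by linarith [hb.1]), sg,
          if_neg hl0.ne', hh]
        ring
  · have hRn : R ≠ 0 := hR.ne'
    unfold Phi at hPs
    rw [max_eq_right (by linarith)] at hPs
    rw [sg, if_neg hRn]
    have : JJ F w R p / R ^ 2 = β * (JJ F w R p / (β * R ^ 2)) := by field_simp
    rw [this, ← hPs]
    ring

lemma source (V : Vol D c M F w) (hβ : 0 < β)
    (hP : ∀ s R, 0 < R → Phi β F w R (P s R) = s) (hE : Continuous E) {B : ℝ} (hN : ∀ x, |E x| ≤ B)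
    (hEg : ∀ x ∈ Icc D N, E x = g x)
    {s R : ℝ} (hR : 0 < R) (hs : D < s) (hsN : s ≤ N) :
    ∫ r in (0:ℝ)..R, Sfun g D ν (sg D w (P s R) r) * r ^ 2 = R ^ 3 * GG ν E w P s R := by
  have hp := V.P_lt hβ hP hR hs
  have hb := fun l => V.sg_bounds hβ hP (l := l) hR hs
  unfold GG
  set p := P s R with hpd
  have hρ : rho p < R := max_lt hp hR
  rw [JJ_eq hρ.le, min_eq_left hρ.le, int_split (A := fun l => -ν * l ^ 2) (rho_nonneg p) hρ.le
    (by fun_prop) (V.lkc hE hN p) (fun l hl => ?_) (fun l hl => ?_)]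
  · rw [intervalIntegral.integral_const_mul, integral_pow]
    field_simp
    norm_num
    ring
  · rw [V.sg_core hl.1 hl.2, Sfun, if_neg (lt_irrefl _)]
  · have hb := hb l hl.1 hl.2
    have hl0 : 0 < l := (rho_nonneg p).trans_lt hl.1
    rw [Sfun, if_pos hb.1, ← hEg _ ⟨hb.1.le, hb.2.trans hsN⟩, sg, if_neg hl0.ne', hh]
    ring

end Vol


noncomputable def stk (G : ℝ → ℝ → ℝ) (δ t x : ℝ) : ℝ := ∫ u in (0:ℝ)..1, G t (x + δ * u)

lemma stk_cont {G : ℝ → ℝ → ℝ} (hG : Continuous (Function.uncurry G)) :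
    Continuous (fun q : ℝ × ℝ × ℝ => stk G q.1 q.2.1 q.2.2) := by
  unfold stk
  refine cont_int (k := fun (q : ℝ × ℝ × ℝ) u => G q.2.1 (q.2.2 + q.1 * u)) ?_
    continuous_const continuous_const
  exact hG.comp (by fun_prop : Continuous fun z : (ℝ × ℝ × ℝ) × ℝ =>
    (z.1.2.1, z.1.2.2 + z.1.1 * z.2))

lemma stk_abs {G : ℝ → ℝ → ℝ} {M : ℝ} (hM : ∀ t x, |G t x| ≤ M) (δ t x : ℝ) :
    |stk G δ t x| ≤ M := by
  have := intervalIntegral.norm_integral_le_of_norm_le_const (a := 0) (b := 1) (C := M)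
    (f := fun u => G t (x + δ * u)) (fun u _ => hM _ _)
  simpa [stk] using this

lemma stk_zero (G : ℝ → ℝ → ℝ) (t x : ℝ) : stk G 0 t x = G t x := by simp [stk]

lemma slice_cont {G : ℝ → ℝ → ℝ} (hG : Continuous (Function.uncurry G)) (t : ℝ) :
    Continuous (G t) := hG.comp (by fun_prop : Continuous fun x : ℝ => (t, x))

lemma stk_nonpos {G : ℝ → ℝ → ℝ} {X δ t x : ℝ} (hG : Continuous (Function.uncurry G))
    (hX : ∀ x ≥ X, ∀ t, G t x ≤ 0) (hδ : 0 ≤ δ)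
    (hx : X ≤ x) : stk G δ t x ≤ 0 := by
  have hc := slice_cont hG t
  have : ∫ u in (0:ℝ)..1, G t (x + δ * u) ≤ ∫ u in (0:ℝ)..1, (0:ℝ) := by
    refine intervalIntegral.integral_mono_on zero_le_one
      ((by fun_prop : Continuous fun u => G t (x + δ * u)).intervalIntegrable _ _)
      (continuous_const.intervalIntegrable _ _) fun u hu => hX _ ?_ _
    have := mul_nonneg hδ hu.1
    linarith
  simpa [stk] using this

lemma stk_near {G : ℝ → ℝ → ℝ} {A δ t x l ε : ℝ} (hG : Continuous (Function.uncurry G))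
    (hA : ∀ y ≤ A, |G t y - l| ≤ ε) (_ : 0 ≤ δ) (hδ1 : δ ≤ 1) (hx : x + 1 ≤ A) :
    |stk G δ t x - l| ≤ ε := by
  have hc := slice_cont hG t
  have h := intervalIntegral.norm_integral_le_of_norm_le_const (a := 0) (b := 1) (C := ε)
    (f := fun u => G t (x + δ * u) - l) (fun u hu => hA _ ?_)
  · rw [intervalIntegral.integral_sub
      ((by fun_prop : Continuous fun u => G t (x + δ * u)).intervalIntegrable _ _)
      (continuous_const.intervalIntegrable _ _)] at h
    simpa [stk] using h
  · rw [uIoc_of_le zero_le_one] at hu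
    nlinarith [hu.1, hu.2]

lemma stk_lip {G : ℝ → ℝ → ℝ} {M δ : ℝ} (hG : Continuous (Function.uncurry G))
    (hM : ∀ t x, |G t x| ≤ M) (hδ : 0 < δ) (t x y : ℝ) :
    |stk G δ t x - stk G δ t y| ≤ (2 * M / δ) * |x - y| := by
  have hc := slice_cont hG t
  have hi : ∀ a b, IntervalIntegrable (G t) volume a b := fun a b => hc.intervalIntegrable _ _
  have e : ∀ x, stk G δ t x = δ⁻¹ * ∫ v in x..(x + δ), G t v := by
    intro x
    have := intervalIntegral.integral_comp_add_mul (a := 0) (b := 1) (G t) hδ.ne' x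
    simpa [stk] using this
  have b : ∀ a b, |∫ v in a..b, G t v| ≤ M * |b - a| := fun a b => by
    rw [← Real.norm_eq_abs]
    exact intervalIntegral.norm_integral_le_of_norm_le_const (fun u _ => hM _ _)
  have e2 : (∫ v in x..(x + δ), G t v) - ∫ v in y..(y + δ), G t v
      = (∫ v in x..y, G t v) - ∫ v in (x+δ)..(y + δ), G t v := by
    have h1 := intervalIntegral.integral_add_adjacent_intervals (hi x y) (hi y (y+δ))
    have h2 := intervalIntegral.integral_add_adjacent_intervals (hi x (x+δ)) (hi (x+δ) (y+δ))
    linarith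
  rw [e, e, ← mul_sub, e2, abs_mul, abs_of_pos (inv_pos.2 hδ)]
  have b1 := b x y
  have b2 := b (x+δ) (y+δ)
  rw [show y + δ - (x + δ) = y - x by ring] at b2
  rw [abs_sub_comm y x] at b1 b2
  have : |(∫ v in x..y, G t v) - ∫ v in (x+δ)..(y + δ), G t v| ≤ 2 * M * |x - y| :=
    (abs_sub _ _).trans (by linarith)
  calc _ ≤ δ⁻¹ * (2 * M * |x - y|) := by gcongr
    _ = _ := by field_simp

structure Sol (H : ℝ → ℝ → ℝ) (ω : ℝ) (x : ℝ → ℝ) : Prop where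
  c : Continuous x
  e : ∀ t ∈ Icc 0 ω, x t = x 0 + ∫ s in (0:ℝ)..t, H s (x s)

lemma Sol.hc {H : ℝ → ℝ → ℝ} {ω : ℝ} {x : ℝ → ℝ} (S : Sol H ω x)
    (hH : Continuous (Function.uncurry H)) : Continuous fun s => H s (x s) :=
  hH.comp (continuous_id.prodMk S.c)

lemma Sol.lip {H : ℝ → ℝ → ℝ} {ω M : ℝ} {x : ℝ → ℝ} (S : Sol H ω x)
    (hH : Continuous (Function.uncurry H)) (hM : ∀ t x, |H t x| ≤ M) {s t : ℝ}
    (hs : s ∈ Icc 0 ω) (ht : t ∈ Icc 0 ω) : |x t - x s| ≤ M * |t - s| := by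
  have hi : ∀ a b, IntervalIntegrable (fun s => H s (x s)) volume a b := fun a b =>
    (S.hc hH).intervalIntegrable _ _
  have : x t - x s = ∫ r in s..t, H r (x r) := by
    have := intervalIntegral.integral_add_adjacent_intervals (hi 0 s) (hi s t)
    rw [S.e t ht, S.e s hs]; linarith
  rw [this, ← Real.norm_eq_abs]
  exact intervalIntegral.norm_integral_le_of_norm_le_const (fun u _ => hM _ _)

lemma picard {H : ℝ → ℝ → ℝ} {ω M K lo hi : ℝ} (hω : 0 < ω)
    (hH : Continuous (Function.uncurry H)) (hM : ∀ t x, |H t x| ≤ M)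
    (hK : ∀ t x y, |H t x - H t y| ≤ K * |x - y|) (hlh : lo ≤ hi) :
    ∃ α : ℝ → ℝ → ℝ, (∀ x ∈ Icc lo hi, Sol H ω (α x) ∧ α x 0 = x) ∧
      ContinuousOn (fun x => α x ω) (Icc lo hi) := by
  have hM0 : 0 ≤ M := (abs_nonneg _).trans (hM 0 0)
  have hK0 : 0 ≤ K := by
    have := (abs_nonneg _).trans (hK 0 1 0)
    simpa using this
  have h0 : (0:ℝ) ∈ Icc 0 ω := ⟨le_rfl, hω.le⟩
  have P : IsPicardLindelof H (⟨0, h0⟩ : Icc (0:ℝ) ω) ((lo + hi)/2)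
      (Real.toNNReal ((hi - lo)/2 + M * ω)) (Real.toNNReal ((hi-lo)/2)) (Real.toNNReal M)
      (Real.toNNReal K) := by
    refine ⟨fun t _ => ?_, fun x _ => ?_, fun t _ x _ => ?_, ?_⟩
    · refine (LipschitzWith.of_dist_le_mul fun x y => ?_).lipschitzOnWith
      rw [Real.coe_toNNReal _ hK0]
      exact hK t x y
    · exact (hH.comp (by fun_prop : Continuous fun t : ℝ => (t, x))).continuousOn
    · rw [Real.coe_toNNReal _ hM0]; exact hM t x
    · rw [Real.coe_toNNReal _ hM0, Real.coe_toNNReal _ (by have := mul_nonneg hM0 hω.le; linarith),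
        Real.coe_toNNReal _ (by linarith)]
      simp [hω.le]
  obtain ⟨α, hα, L', hL⟩ := P.exists_forall_mem_closedBall_eq_hasDerivWithinAt_lipschitzOnWith
  have hball : Metric.closedBall ((lo+hi)/2) (Real.toNNReal ((hi-lo)/2) : ℝ) = Icc lo hi := by
    rw [Real.coe_toNNReal _ (by linarith), Real.closedBall_eq_Icc]
    congr 1 <;> ring
  rw [hball] at hα hL
  refine ⟨fun x t => α x (max 0 (min t ω)), fun x hx => ⟨⟨?_, ?_⟩, ?_⟩, ?_⟩
  · have hc : ContinuousOn (α x) (Icc 0 ω) := fun t ht => ((hα x hx).2 t ht).continuousWithinAt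
    exact hc.comp_continuous (by fun_prop) fun t =>
      ⟨le_max_left _ _, max_le hω.le (min_le_right _ _)⟩
  · intro t ht
    have hc : ContinuousOn (α x) (Icc 0 ω) := fun t ht => ((hα x hx).2 t ht).continuousWithinAt
    have hcl : ∀ s ∈ Icc 0 ω, max 0 (min s ω) = s := fun s hs => by
      rw [min_eq_left hs.2, max_eq_right hs.1]
    have hsub : Icc 0 t ⊆ Icc 0 ω := Icc_subset_Icc_right ht.2
    have hcH : ContinuousOn (fun s => H s (α x s)) (Icc 0 ω) :=
      hH.comp_continuousOn (continuousOn_id.prodMk hc)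
    have := intervalIntegral.integral_eq_sub_of_hasDerivAt_of_le ht.1 (hc.mono hsub)
      (f' := fun s => H s (α x s)) (fun s hs => ((hα x hx).2 s (hsub (Ioo_subset_Icc_self hs))).hasDerivAt
        (Icc_mem_nhds hs.1 (hs.2.trans_le ht.2)))
      ((hcH.mono hsub).intervalIntegrable_of_Icc ht.1)
    have e2 : ∫ s in (0:ℝ)..t, H s (α x (max 0 (min s ω))) = ∫ s in (0:ℝ)..t, H s (α x s) := by
      refine intervalIntegral.integral_congr fun s hs => ?_
      rw [uIcc_of_le ht.1] at hs
      simp only [hcl s (hsub hs)]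
    simp only [e2, hcl t ht, hcl 0 h0, this]
    ring
  · simp only [hω.le, min_eq_left, max_self]
    exact (hα x hx).1
  · simp only [min_self, max_eq_right hω.le]
    exact (hL ω ⟨hω.le, le_rfl⟩).continuousOn

lemma periodic_lip {H : ℝ → ℝ → ℝ} {ω M K lo hi : ℝ} (hω : 0 < ω)
    (hH : Continuous (Function.uncurry H)) (hM : ∀ t x, |H t x| ≤ M)
    (hK : ∀ t x y, |H t x - H t y| ≤ K * |x - y|) (hlh : lo ≤ hi)
    (h1 : ∀ x, Sol H ω x → x 0 = lo → x 0 ≤ x ω) (h2 : ∀ x, Sol H ω x → x 0 = hi → x ω ≤ x 0) :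
    ∃ x, Sol H ω x ∧ x 0 ∈ Icc lo hi ∧ x ω = x 0 := by
  obtain ⟨α, hα, hc⟩ := picard hω hH hM hK hlh
  have hl := hα lo ⟨le_rfl, hlh⟩
  have hh := hα hi ⟨hlh, le_rfl⟩
  have a1 := h1 _ hl.1 hl.2
  have a2 := h2 _ hh.1 hh.2
  obtain ⟨z, hz, hz2⟩ := intermediate_value_Icc' hlh (hc.sub continuousOn_id)
    (show (0:ℝ) ∈ Icc _ _ from ⟨by simpa [hh.2] using a2, by simpa [hl.2] using a1⟩)
  have := hα z hz
  refine ⟨α z, this.1, by rw [this.2]; exact hz, ?_⟩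
  rw [this.2]
  simpa [sub_eq_zero] using hz2

lemma low_bound {G : ℝ → ℝ → ℝ} {ω M : ℝ} {L : ℝ → ℝ} (hω : 0 < ω)
    (hG : Continuous (Function.uncurry G)) (hM : ∀ t x, |G t x| ≤ M)
    (hL : ∀ t, Tendsto (G t) atBot (𝓝 (L t))) (hpos : 0 < ∫ t in (0:ℝ)..ω, L t) :
    ∃ A : ℝ, ∀ δ, 0 < δ → δ ≤ 1 → ∀ x, Sol (stk G δ) ω x → x 0 ≤ A → x 0 ≤ x ω := by
  by_contra! hcon
  choose d hd0 hd1 x hS hx hlt using fun k : ℕ => hcon (-(k:ℝ))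
  have hcont : ∀ δ, Continuous (Function.uncurry (stk G δ)) := fun δ =>
    (stk_cont hG).comp (by fun_prop : Continuous fun q : ℝ × ℝ => (δ, q.1, q.2))
  have h0 : (0:ℝ) ∈ Icc 0 ω := ⟨le_rfl, hω.le⟩
  have hlim : Tendsto (fun k => ∫ s in (0:ℝ)..ω, stk G (d k) s (x k s)) atTop
      (𝓝 (∫ s in (0:ℝ)..ω, L s)) := by
    refine intervalIntegral.tendsto_integral_filter_of_dominated_convergence (fun _ => M)
      (Eventually.of_forall fun k => ((hS k).hc (hcont _)).aestronglyMeasurable)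
      (Eventually.of_forall fun k => Eventually.of_forall fun s _ => stk_abs hM _ _ _)
      (continuous_const.intervalIntegrable _ _) (Eventually.of_forall fun s hs => ?_)
    rw [uIoc_of_le hω.le] at hs
    rw [Metric.tendsto_atTop]
    intro ε hε
    have := (Metric.tendsto_nhds.1 (hL s)) (ε/2) (half_pos hε)
    obtain ⟨A, hA⟩ := eventually_atBot.1 this
    obtain ⟨n, hn⟩ := exists_nat_ge (M * ω + 1 - A)
    refine ⟨n, fun k hk => ?_⟩
    have hkn : (n:ℝ) ≤ k := by exact_mod_cast hk
    have hl := (abs_le.1 ((hS k).lip (hcont _) (stk_abs hM _) h0 ⟨hs.1.le, hs.2⟩)).2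
    rw [sub_zero, abs_of_pos hs.1] at hl
    have hM0 : 0 ≤ M := (abs_nonneg _).trans (hM 0 0)
    have hms : M * s ≤ M * ω := mul_le_mul_of_nonneg_left hs.2 hM0
    have := stk_near (δ := d k) (x := x k s) hG (fun y hy => (hA y hy).le) (hd0 k).le (hd1 k)
      (by linarith [hx k])
    rw [Real.dist_eq]; linarith
  have hle : ∫ s in (0:ℝ)..ω, L s ≤ 0 := by
    refine le_of_tendsto hlim (Eventually.of_forall fun k => ?_)
    have := (hS k).e ω ⟨hω.le, le_rfl⟩
    linarith [hlt k]
  linarith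

lemma high_bound {H : ℝ → ℝ → ℝ} {ω M X : ℝ} (hω : 0 < ω)
    (hH : Continuous (Function.uncurry H)) (hM : ∀ t x, |H t x| ≤ M)
    (hX : ∀ x ≥ X, ∀ t, H t x ≤ 0) {x : ℝ → ℝ} (S : Sol H ω x) (hx : X + M * ω ≤ x 0) :
    x ω ≤ x 0 := by
  have hM0 : 0 ≤ M := (abs_nonneg _).trans (hM 0 0)
  have h0 : (0:ℝ) ∈ Icc 0 ω := ⟨le_rfl, hω.le⟩
  have : ∫ s in (0:ℝ)..ω, H s (x s) ≤ ∫ s in (0:ℝ)..ω, (0:ℝ) := by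
    refine intervalIntegral.integral_mono_on hω.le ((S.hc hH).intervalIntegrable _ _)
      (continuous_const.intervalIntegrable _ _) fun s hs => hX _ ?_ _
    have hl := (abs_le.1 (S.lip hH hM h0 hs)).1
    rw [sub_zero, abs_of_nonneg hs.1] at hl
    have hms : M * s ≤ M * ω := mul_le_mul_of_nonneg_left hs.2 hM0
    linarith
  rw [S.e ω ⟨hω.le, le_rfl⟩]
  simp only [intervalIntegral.integral_zero] at this
  linarith

lemma approx {G : ℝ → ℝ → ℝ} {ω M X : ℝ} {L : ℝ → ℝ} (hω : 0 < ω)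
    (hG : Continuous (Function.uncurry G)) (hM : ∀ t x, |G t x| ≤ M)
    (hX : ∀ x ≥ X, ∀ t, G t x ≤ 0)
    (hL : ∀ t, Tendsto (G t) atBot (𝓝 (L t))) (hpos : 0 < ∫ t in (0:ℝ)..ω, L t) :
    ∃ B : ℝ, ∀ δ, 0 < δ → δ ≤ 1 → ∃ x, Sol (stk G δ) ω x ∧ |x 0| ≤ B ∧ x ω = x 0 := by
  obtain ⟨A, hA⟩ := low_bound hω hG hM hL hpos
  have hcont : ∀ δ, Continuous (Function.uncurry (stk G δ)) := fun δ =>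
    (stk_cont hG).comp (by fun_prop : Continuous fun q : ℝ × ℝ => (δ, q.1, q.2))
  refine ⟨max |min A (X + M * ω)| |X + M * ω|, fun δ h0 h1 => ?_⟩
  obtain ⟨x, hx, hx0, hx1⟩ := periodic_lip (lo := min A (X + M * ω)) (hi := X + M * ω) hω
    (hcont δ) (stk_abs hM δ) (stk_lip hG hM h0) (min_le_right _ _)
    (fun x hS hx => hA δ h0 h1 x hS (hx.trans_le (min_le_left _ _)))
    (fun x hS hx => high_bound hω (hcont δ) (stk_abs hM δ)
      (fun y hy t => stk_nonpos hG hX h0.le hy) hS hx.ge)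
  exact ⟨x, hx, abs_le_max_abs_abs hx0.1 hx0.2, hx1⟩

lemma exists_sol {G : ℝ → ℝ → ℝ} {ω M X : ℝ} {L : ℝ → ℝ} (hω : 0 < ω)
    (hG : Continuous (Function.uncurry G)) (hM : ∀ t x, |G t x| ≤ M)
    (hX : ∀ x ≥ X, ∀ t, G t x ≤ 0)
    (hL : ∀ t, Tendsto (G t) atBot (𝓝 (L t))) (hpos : 0 < ∫ t in (0:ℝ)..ω, L t) :
    ∃ x, Sol G ω x ∧ x ω = x 0 := by
  obtain ⟨B, hB⟩ := approx hω hG hM hX hL hpos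
  have hM0 : 0 ≤ M := (abs_nonneg _).trans (hM 0 0)
  have h0 : (0:ℝ) ∈ Icc 0 ω := ⟨le_rfl, hω.le⟩
  have hcont : ∀ δ, Continuous (Function.uncurry (stk G δ)) := fun δ =>
    (stk_cont hG).comp (by fun_prop : Continuous fun q : ℝ × ℝ => (δ, q.1, q.2))
  let d : ℕ → ℝ := fun n => 1 / ((n:ℝ) + 1)
  have hd0 : ∀ n, 0 < d n := fun n => Nat.one_div_pos_of_nat
  have hd1 : ∀ n, d n ≤ 1 := fun n => by
    simp only [d]; rw [div_le_one (by positivity)]; linarith [(Nat.cast_nonneg n : (0:ℝ) ≤ n)]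
  choose x hS hx0 hxp using fun n => hB (d n) (hd0 n) (hd1 n)
  let y : ℕ → BoundedContinuousFunction (Icc (0:ℝ) ω) ℝ := fun n =>
    BoundedContinuousFunction.mkOfCompact ⟨fun t => x n t, (hS n).c.comp continuous_subtype_val⟩
  have hlip : ∀ n (s t : Icc (0:ℝ) ω), |x n t - x n s| ≤ M * |(t:ℝ) - s| := fun n s t =>
    (hS n).lip (hcont _) (stk_abs hM _) s.2 t.2
  have hcomp : IsCompact (closure (range y)) := by
    refine BoundedContinuousFunction.arzela_ascoli (Icc (-(B + M * ω)) (B + M * ω)) isCompact_Icc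
      _ ?_ ?_
    · rintro _ t ⟨n, rfl⟩
      have h1 := hlip n ⟨0, h0⟩ t
      simp only [sub_zero] at h1
      rw [abs_of_nonneg t.2.1] at h1
      have h2 := mul_le_mul_of_nonneg_left t.2.2 hM0
      have h3 := abs_le.1 (hx0 n)
      have h4 := abs_le.1 h1
      show x n t ∈ _
      constructor <;> linarith [h3.1, h3.2, h4.1, h4.2]
    · refine (LipschitzWith.uniformEquicontinuous _ (Real.toNNReal M) ?_).equicontinuous
      rintro ⟨_, n, rfl⟩
      refine LipschitzWith.of_dist_le_mul fun t s => ?_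
      rw [Real.coe_toNNReal _ hM0]
      exact hlip n s t
  obtain ⟨z, -, ψ, hψ, hz⟩ := hcomp.tendsto_subseq (fun n => subset_closure (mem_range_self n))
  have hpt : ∀ t : Icc (0:ℝ) ω, Tendsto (fun n => x (ψ n) t) atTop (𝓝 (z t)) := fun t =>
    ((by fun_prop : Continuous fun h : BoundedContinuousFunction (Icc (0:ℝ) ω) ℝ => h t).tendsto z).comp hz
  have hdl : Tendsto (fun n => d (ψ n)) atTop (𝓝 0) :=
    tendsto_one_div_add_atTop_nhds_zero_nat.comp hψ.tendsto_atTop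
  have key : ∀ t : Icc (0:ℝ) ω, z t = z ⟨0, h0⟩ + ∫ s in (0:ℝ)..t, G s (z (projIcc 0 ω hω.le s)) := by
    intro t
    refine tendsto_nhds_unique (hpt t) ?_
    have : ∀ n, x (ψ n) t = x (ψ n) 0 + ∫ s in (0:ℝ)..t, stk G (d (ψ n)) s (x (ψ n) s) :=
      fun n => (hS _).e t t.2
    simp only [this]
    refine (hpt ⟨0, h0⟩).add ?_
    refine intervalIntegral.tendsto_integral_filter_of_dominated_convergence (fun _ => M)
      (Eventually.of_forall fun k => ((hS _).hc (hcont _)).aestronglyMeasurable)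
      (Eventually.of_forall fun k => Eventually.of_forall fun s _ => stk_abs hM _ _ _)
      (continuous_const.intervalIntegrable _ _) (Eventually.of_forall fun s hs => ?_)
    rw [uIoc_of_le t.2.1] at hs
    have hs' : s ∈ Icc 0 ω := ⟨hs.1.le, hs.2.trans t.2.2⟩
    rw [projIcc_of_mem hω.le hs', ← stk_zero G]
    exact ((stk_cont hG).tendsto (0, s, z ⟨s, hs'⟩)).comp
      (hdl.prodMk_nhds (tendsto_const_nhds.prodMk_nhds (hpt ⟨s, hs'⟩)))
  have e0 : projIcc 0 ω hω.le 0 = ⟨0, h0⟩ := projIcc_of_mem hω.le h0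
  refine ⟨fun t => z (projIcc 0 ω hω.le t), ⟨z.continuous.comp continuous_projIcc, fun t ht => ?_⟩, ?_⟩
  · simp only [e0]
    rw [projIcc_of_mem hω.le ht]
    exact key ⟨t, ht⟩
  · have hω' : ω ∈ Icc 0 ω := ⟨hω.le, le_rfl⟩
    simp only [e0]
    rw [projIcc_of_mem hω.le hω']
    refine tendsto_nhds_unique (hpt ⟨ω, hω'⟩) ?_
    simp only [hxp]
    exact hpt ⟨0, h0⟩

theorem exists_periodic {G : ℝ → ℝ → ℝ} {ω M X : ℝ} {L : ℝ → ℝ} (hω : 0 < ω)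
    (hG : Continuous (Function.uncurry G)) (hM : ∀ t x, |G t x| ≤ M)
    (hper : ∀ t x, G (t + ω) x = G t x)
    (hX : ∀ x ≥ X, ∀ t, G t x ≤ 0)
    (hL : ∀ t, Tendsto (G t) atBot (𝓝 (L t))) (hpos : 0 < ∫ t in (0:ℝ)..ω, L t) :
    ∃ x : ℝ → ℝ, Function.Periodic x ω ∧ ∀ t, HasDerivAt x (G t (x t)) t := by
  obtain ⟨x, hS, hx⟩ := exists_sol hω hG hM hX hL hpos
  have : Fact (0 < ω) := ⟨hω⟩
  let Z : ℝ → ℝ := fun t => AddCircle.liftIco ω 0 x (t : AddCircle ω)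
  have hZc : Continuous Z :=
    (AddCircle.liftIco_zero_continuous hx.symm hS.c.continuousOn).comp (AddCircle.continuous_mk' ω)
  have hZp : Function.Periodic Z ω := fun t => by
    simp [Z]
  have hZe : ∀ t ∈ Icc 0 ω, Z t = x t := by
    intro t ht
    rcases eq_or_lt_of_le ht.2 with h | h
    · rw [h, hx]
      have := hZp 0
      rw [zero_add] at this
      rw [this]
      exact AddCircle.liftIco_zero_coe_apply ⟨le_rfl, hω⟩
    · exact AddCircle.liftIco_zero_coe_apply ⟨ht.1, h⟩
  have hgc : Continuous fun s => G s (Z s) := hG.comp (continuous_id.prodMk hZc)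
  have hgp : Function.Periodic (fun s => G s (Z s)) ω := fun s => by
    simp only [hZp s, hper]
  have hY : ∀ t ∈ Icc 0 ω, Z t = x 0 + ∫ s in (0:ℝ)..t, G s (Z s) := by
    intro t ht
    rw [hZe t ht, hS.e t ht]
    congr 1
    refine intervalIntegral.integral_congr fun s hs => ?_
    rw [uIcc_of_le ht.1] at hs
    simp only [hZe s ⟨hs.1, hs.2.trans ht.2⟩]
  have hint0 : ∫ s in (0:ℝ)..ω, G s (Z s) = 0 := by
    have h1 := hY ω ⟨hω.le, le_rfl⟩
    rw [hZe ω ⟨hω.le, le_rfl⟩, hx] at h1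
    linarith
  have hYp : Function.Periodic (fun t => x 0 + ∫ s in (0:ℝ)..t, G s (Z s)) ω := by
    intro t
    have h1 := intervalIntegral.integral_add_adjacent_intervals
      (hgc.intervalIntegrable 0 t (μ := volume)) (hgc.intervalIntegrable t (t + ω))
    have h2 := hgp.intervalIntegral_add_eq t 0
    rw [zero_add, hint0] at h2
    simp only []
    linarith
  have hall : ∀ t, Z t = x 0 + ∫ s in (0:ℝ)..t, G s (Z s) := by
    intro t
    obtain ⟨y, hy, hty⟩ := (hZp.sub hYp).exists_mem_Ico₀ hω t
    have := hY y ⟨hy.1, hy.2.le⟩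
    simp only [Pi.sub_apply] at hty
    linarith
  refine ⟨Z, hZp, fun t => ?_⟩
  have h1 := (intervalIntegral.integral_hasDerivAt_right (hgc.intervalIntegrable 0 t)
    hgc.aestronglyMeasurable.stronglyMeasurableAtFilter hgc.continuousAt).const_add (x 0)
  exact h1.congr_of_eventuallyEq (Eventually.of_forall hall)


noncomputable def clp (D N x : ℝ) : ℝ := max D (min x N)

lemma clp_mem {D N : ℝ} (h : D ≤ N) (x : ℝ) : clp D N x ∈ Icc D N :=
  ⟨le_max_left _ _, max_le h (min_le_right _ _)⟩

lemma clp_eq {D N x : ℝ} (h : x ∈ Icc D N) : clp D N x = x := by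
  rw [clp, min_eq_left h.2, max_eq_right h.1]

lemma clp_cont (D N : ℝ) : Continuous (clp D N) := by unfold clp; fun_prop

lemma clp_mono (D N : ℝ) : Monotone (clp D N) := fun _ _ h =>
  max_le_max le_rfl (min_le_min_right _ h)

lemma clp_lip (D N x y : ℝ) : |clp D N x - clp D N y| ≤ |x - y| := by
  unfold clp
  rw [max_comm D, max_comm D]
  refine (abs_max_sub_max_le_abs _ _ _).trans ?_
  have h1 : LipschitzWith 1 (fun x : ℝ => min x N) := LipschitzWith.id.min_const N
  simpa [Real.dist_eq] using h1.dist_le_mul x y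

lemma const_stat {f : ℝ → ℝ} {β σD s R : ℝ} (h : s ≤ σD) :
    IsStationarySol f β σD s R (fun _ => s) (fun _ => 0) := by
  refine ⟨continuousOn_const, fun r _ => hasDerivWithinAt_const _ _ _, fun r _ => ?_, by simp⟩
  simp [Hside, not_lt.2 h]

lemma const_source {g : ℝ → ℝ} {ν σD s R : ℝ} (h : s ≤ σD) :
    ∫ r in (0:ℝ)..R, Sfun g σD ν s * r ^ 2 = R ^ 3 * (-ν / 3) := by
  rw [intervalIntegral.integral_const_mul, integral_pow]
  simp only [Sfun, not_lt.2 h, if_false]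
  norm_num
  ring

/-- If (A1)–(A3) hold and $\bar S > 0$, then the evolutionary tumor problem admits
a positive $ω$-time periodic solution $(σ_{per}, R_{per})$. -/
theorem stmt_2 (β σD ν ω : ℝ) (hβ : 0 < β) (hσD : 0 < σD) (hν : 0 < ν) (hω : 0 < ω)
    (f g : ℝ → ℝ) (hf : C1StrictInc f) (hf0 : f 0 = 0)
    (hg : C1StrictInc g) (hgz : ∃ σt > σD, g σt = 0) (hgν : 0 ≤ g σD + ν)
    (φ : ℝ → ℝ) (hφc : Continuous φ) (hφpos : ∀ t, 0 < φ t)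
    (hφper : Function.Periodic φ ω)
    (hSbar : 0 < (1 / ω) * ∫ t in (0:ℝ)..ω, Sfun g σD ν (φ t)) :
    ∃ (σper : ℝ → ℝ → ℝ) (Rper Rper' : ℝ → ℝ),
      IsEvolutionSol f g β σD ν φ σper Rper Rper' ∧
      (∀ t ≥ (0:ℝ), Rper (t + ω) = Rper t) ∧
      (∀ t ≥ (0:ℝ), ∀ r ∈ Icc (0:ℝ) (Rper t), σper r (t + ω) = σper r t) := by
  obtain ⟨N0, hN0⟩ : ∃ N0, ∀ t, φ t ≤ N0 := by
    obtain ⟨b, hb⟩ := (isCompact_Icc (a := (0:ℝ)) (b := ω)).bddAbove_image hφc.continuousOn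
    refine ⟨b, fun t => ?_⟩
    obtain ⟨y, hy, hty⟩ := hφper.exists_mem_Ico₀ hω t
    rw [hty]
    exact hb ⟨y, ⟨hy.1, hy.2.le⟩, rfl⟩
  set N := max N0 σD with hNdef
  have hDN : σD ≤ N := le_max_right _ _
  have hφN : ∀ t, φ t ≤ N := fun t => (hN0 t).trans (le_max_left _ _)
  have hsub : Icc σD N ⊆ Ici (0:ℝ) := fun x hx => hσD.le.trans hx.1
  have hm := clp_mem hDN
  set F : ℝ → ℝ := fun x => f (clp σD N x) with hFdef
  set E : ℝ → ℝ := fun x => g (clp σD N x) with hEdef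
  have hFc : Continuous F := (hf.1.continuousOn.mono hsub).comp_continuous (clp_cont _ _) hm
  have hEc : Continuous E := (hg.1.continuousOn.mono hsub).comp_continuous (clp_cont _ _) hm
  obtain ⟨M, hM⟩ : ∃ M, ∀ x, |F x| ≤ M := by
    obtain ⟨C, hC⟩ := (isCompact_Icc (a := σD) (b := N)).exists_bound_of_continuousOn
      (hf.1.continuousOn.mono hsub)
    exact ⟨C, fun x => hC _ (hm x)⟩
  obtain ⟨B, hB⟩ : ∃ M, ∀ x, |E x| ≤ M := by
    obtain ⟨C, hC⟩ := (isCompact_Icc (a := σD) (b := N)).exists_bound_of_continuousOn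
      (hg.1.continuousOn.mono hsub)
    exact ⟨C, fun x => hC _ (hm x)⟩
  have hFm : Monotone F := fun x y h =>
    hf.2.monotoneOn (hsub (hm x)) (hsub (hm y)) (clp_mono _ _ h)
  have hc : 0 < f σD := by
    rw [← hf0]; exact hf.2 (mem_Ici.2 le_rfl) (mem_Ici.2 hσD.le) hσD
  have hcF : ∀ x, f σD ≤ F x := fun x =>
    hf.2.monotoneOn (mem_Ici.2 hσD.le) (hsub (hm x)) (hm x).1
  obtain ⟨K, hK⟩ := (hf.1.mono hsub).exists_lipschitzOnWith one_ne_zero (convex_Icc _ _)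
    isCompact_Icc
  have hKF : ∀ x y, |F x - F y| ≤ K * |x - y| := fun x y =>
    (hK.dist_le_mul _ (hm x) _ (hm y)).trans
      (mul_le_mul_of_nonneg_left (clp_lip _ _ x y) K.2)
  obtain ⟨w, wc, weq, wanti⟩ := volterra σD hFc hFm K.2 hKF hM fun x => hc.le.trans (hcF x)
  have V : Vol σD (f σD) M F w := ⟨hσD, hc, hFc, hFm, hM, hcF, wc, weq, wanti⟩
  obtain ⟨P, hP, hPc⟩ := V.exists_P hβ
  have hFf : ∀ x ∈ Icc σD N, F x = f x := fun x hx => by simp only [hFdef, clp_eq hx]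
  have hEg : ∀ x ∈ Icc σD N, E x = g x := fun x hx => by simp only [hEdef, clp_eq hx]
  obtain ⟨R0, hR0, hneg⟩ := V.GG_neg hβ hν hP hEc hB (smax := N)
  obtain ⟨x, hxp, hxd⟩ := exists_periodic (G := fun t x => GG ν E w P (φ t) (Real.exp x))
    (M := ν + B) (X := Real.log R0) (L := fun t => Sfun g σD ν (φ t) / 3) hω
    (by
      rw [continuous_iff_continuousAt]
      rintro ⟨t, x⟩
      exact ContinuousAt.comp (g := fun q : ℝ × ℝ => GG ν E w P q.1 q.2)
        (f := fun q : ℝ × ℝ => (φ q.1, Real.exp q.2))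
        (V.GG_cont hEc hB hPc (Real.exp_pos x))
        (by fun_prop : Continuous fun q : ℝ × ℝ => (φ q.1, Real.exp q.2)).continuousAt)
    (fun t x => Vol.GG_abs hν hB (Real.exp_pos x))
    (fun t x => by simp only [hφper t])
    (fun x hx t => hneg _ (hφN t) _ ((Real.log_le_iff_le_exp hR0).1 hx))
    (fun t => by
      rcases le_or_gt (φ t) σD with h | h
      · simp only [V.GG_low hβ hP (Real.exp_pos _) h, Sfun, not_lt.2 h, if_false]
        exact tendsto_const_nhds
      · simp only [Sfun, h, if_true]
        rw [← hEg _ ⟨h.le, hφN t⟩]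
        exact (V.GG_lim hβ hP hEc hB h).comp Real.tendsto_exp_atBot_nhdsGT)
    (by
      rw [intervalIntegral.integral_div]
      have : 0 < ∫ t in (0:ℝ)..ω, Sfun g σD ν (φ t) :=
        (pos_iff_pos_of_mul_pos hSbar).1 (by positivity)
      positivity)
  refine ⟨fun r t => if φ t ≤ σD then φ t else sg σD w (P (φ t) (Real.exp (x t))) r,
    fun t => Real.exp (x t), fun t => Real.exp (x t) * GG ν E w P (φ t) (Real.exp (x t)),
    ⟨fun t _ => Real.exp_pos _, fun t _ => ?_, fun t _ => ((hxd t).exp).hasDerivWithinAt,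
      fun t _ => ?_⟩, fun t _ => ?_, fun t _ r _ => ?_⟩
  · by_cases h : φ t ≤ σD
    · simp only [h, if_true]
      exact ⟨_, const_stat h⟩
    · simp only [h, if_false]
      exact ⟨_, V.stationary hβ hP hFf (Real.exp_pos _) (not_le.1 h) (hφN t)⟩
  · by_cases h : φ t ≤ σD
    · simp only [h, if_true]
      rw [const_source h, V.GG_low hβ hP (Real.exp_pos _) h]
      ring
    · simp only [h, if_false]
      rw [V.source hβ hP hEc hB hEg (Real.exp_pos _) (not_le.1 h) (hφN t)]
      ring
  · simp only [hxp t]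
  · simp only [hxp t, hφper t]
end
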